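/- arXiv:2103.01799 — 2 statements merged into one kernel-verified Lean document; each statement's English description precedes it below -/
import Mathlib

section
/- Let p be a prime, h ≥ 2 an integer, q := p^h with q > 27, and let c be a codeword of the code C_1(2,q). If either (h > 2 and wt(c) ≤ q·√q − q, where √q denotes the real square root of q) or (h = 2 and wt(c) ≤ (1/2)·p^3 − (9/4)·p^2), then c is a linear combination of exactly ⌈wt(c)/(q+1)⌉ different lines, i.e. there exist m := ⌈wt(c)/(q+1)⌉ pairwise distinct lines L_1, …, L_m of PG(2,q) and nonzero scalars α_1, …, α_m ∈ ℤ/pℤ with c = α_1·f_{L_1} + … + α_m·f_{L_m}. -/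
open Module

noncomputable section

/-- `pgTheta q m = 1 + q + … + q^m` for `m ≥ 0`, and `0` for `m < 0`. -/
def pgTheta (q : ℕ) (m : ℤ) : ℤ := ∑ i ∈ Finset.range (m + 1).toNat, (q : ℤ) ^ i

/-- `q^j`, truncated to `0` for negative exponents `j`. -/
def pgQpow (q : ℕ) (j : ℤ) : ℤ := if j < 0 then 0 else (q : ℤ) ^ j.toNat

/-- `Δ_{i,q}` where `q = p^h`: `⌊√q / 2^(i-2)⌋` if `h > 2`, and `⌊p / 2^i⌋` if `h = 2`. -/
noncomputable def pgDelta (p h : ℕ) (i : ℤ) : ℤ :=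
  if 2 < h then ⌊Real.sqrt ((p : ℝ) ^ h) / (2 : ℝ) ^ (i - 2)⌋
  else ⌊(p : ℝ) / (2 : ℝ) ^ i⌋

/-- `W(i,q) = (Δ_{i,q} - 1)·θ_{i-1}`. -/
noncomputable def pgW (p h : ℕ) (i : ℤ) : ℤ := (pgDelta p h i - 1) * pgTheta (p ^ h) (i - 1)

/-- `U(n,i,q) = q^i − (Δ_{n,q} − 2)·⌊q^(i−1)⌋ − (i−2)·((q−1)·Δ_{n,q} + 1)·⌊q^(i−3)⌋ + θ_{i−3}`. -/
noncomputable def pgU (p h n : ℕ) (i : ℤ) : ℤ :=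
  pgQpow (p ^ h) i - (pgDelta p h n - 2) * pgQpow (p ^ h) (i - 1)
    - (i - 2) * ((((p ^ h : ℕ) : ℤ) - 1) * pgDelta p h n + 1) * pgQpow (p ^ h) (i - 3)
    + pgTheta (p ^ h) (i - 3)

/-- `⌈w / θ_m⌉` as a natural number. -/
noncomputable def pgCeil (q w : ℕ) (m : ℤ) : ℕ := (⌈(w : ℚ) / ((pgTheta q m : ℤ) : ℚ)⌉).toNat
open scoped Classical

/-- A point of `PG(n,q)`: a 1-dimensional subspace of `F^(n+1)`. -/
abbrev PGPoint (F : Type) [Field F] (n : ℕ) :=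
  {P : Submodule F (Fin (n + 1) → F) // finrank F P = 1}

/-- The indicator function of a subspace `κ`, with values in `ZMod p`. -/
noncomputable def pgInd (p : ℕ) (F : Type) [Field F] (n : ℕ)
    (κ : Submodule F (Fin (n + 1) → F)) : PGPoint F n → ZMod p :=
  fun P => if P.1 ≤ κ then 1 else 0

/-- The code `C_{n-1}(n,q)`: the `ZMod p`-span of the indicator functions of all
hyperplanes (i.e. `n`-dimensional subspaces of `F^(n+1)`). -/
noncomputable def pgCode (p : ℕ) (F : Type) [Field F] (n : ℕ) :
    Submodule (ZMod p) (PGPoint F n → ZMod p) :=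
  Submodule.span (ZMod p)
    {f | ∃ H : Submodule F (Fin (n + 1) → F), finrank F H = n ∧ f = pgInd p F n H}

/-- The weight of a codeword: the number of points where it is nonzero. -/
noncomputable def pgWt (p : ℕ) (F : Type) [Field F] (n : ℕ)
    (c : PGPoint F n → ZMod p) : ℕ :=
  Set.ncard {P : PGPoint F n | c P ≠ 0}

/-- The number of points of `supp c` lying in the subspace `κ`. -/
noncomputable def pgSecant (p : ℕ) (F : Type) [Field F] (n : ℕ)
    (c : PGPoint F n → ZMod p) (κ : Submodule F (Fin (n + 1) → F)) : ℕ :=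
  Set.ncard {P : PGPoint F n | c P ≠ 0 ∧ P.1 ≤ κ}

/-- A codeword `c` is minimal if every codeword whose support is contained in the
support of `c` is a scalar multiple of `c`. -/
noncomputable def pgMinimal (p : ℕ) (F : Type) [Field F] (n : ℕ)
    (c : PGPoint F n → ZMod p) : Prop :=
  ∀ c' ∈ pgCode p F n, {P : PGPoint F n | c' P ≠ 0} ⊆ {P : PGPoint F n | c P ≠ 0} →
    ∃ α : ZMod p, c' = α • c

section Hankel

open Polynomial

theorem natDegree_det_le_sum {F : Type*} [Field F] {n : ℕ} (M : Matrix (Fin n) (Fin n) F[X])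
    (a b : Fin n → ℕ) (hM : ∀ i j, (M i j).natDegree ≤ a i + b j) :
    M.det.natDegree ≤ ∑ i, a i + ∑ i, b i := by
  rw [Matrix.det_apply]
  refine natDegree_sum_le_of_forall_le _ _ fun τ _ => ?_
  refine (natDegree_smul_le _ _).trans ((natDegree_prod_le _ _).trans ?_)
  calc ∑ i, (M (τ i) i).natDegree ≤ ∑ i, (a (τ i) + b i) := Finset.sum_le_sum fun i _ => hM _ _
    _ = ∑ i, a i + ∑ i, b i := by
      rw [Finset.sum_add_distrib, Equiv.sum_comp τ a]

variable {F : Type*} [Field F] [Fintype F]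

/-- The Hankel matrix with entries `σ (i + j)`. -/
def hankel (n : ℕ) (σ : ℕ → F[X]) : Matrix (Fin n) (Fin n) F[X] :=
  Matrix.of fun i j => σ (i + j)

theorem X_sub_C_pow_dvd_det_hankel (n : ℕ) (σ : ℕ → F[X]) (g : F → F) (y : F)
    (hσ : ∀ i, (σ i).eval y = ∑ x, g x * x ^ i) :
    (X - C y) ^ (n - (Finset.univ.filter fun x => g x ≠ 0).card) ∣ (hankel n σ).det := by
  set B := Finset.univ.filter fun x => g x ≠ 0 with hB
  set t := B.card with ht
  let P : Fin n → F[X] := fun j =>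
    if t ≤ j then (∏ b ∈ B, (X - C b)) * X ^ ((j : ℕ) - t) else X ^ (j : ℕ)
  have hmon : (∏ b ∈ B, (X - C b)).Monic := monic_prod_of_monic _ _ fun b _ => monic_X_sub_C b
  have hPmon : ∀ j, (P j).Monic := by
    intro j
    by_cases hj : t ≤ j
    · simpa [P, hj] using hmon.mul (monic_X_pow _)
    · simp [P, hj, monic_X_pow]
  have hPdeg : ∀ j, (P j).natDegree = j := by
    intro j
    by_cases hj : t ≤ j
    · simp only [P, hj, if_true]
      rw [hmon.natDegree_mul (monic_X_pow _), natDegree_X_pow, natDegree_finsetProd_X_sub_C_eq_card]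
      omega
    · simp [P, hj]
  set A : Matrix (Fin n) (Fin n) F[X] :=
    (Matrix.of fun i j : Fin n => (P j).coeff i).map C with hA
  have hAdet : A.det = 1 := by
    have := Matrix.det_matrixOfPolynomials P hPdeg hPmon
    have h2 := RingHom.map_det (C : F →+* F[X]) (Matrix.of fun i j : Fin n => (P j).coeff i)
    rw [this, map_one] at h2
    rw [h2]; rfl
  have hzero : ∀ i j : Fin n, t ≤ j → ((hankel n σ * A) i j).eval y = 0 := by
    intro i j hj
    have h1 : ((hankel n σ * A) i j).eval y = ∑ x, g x * x ^ (i : ℕ) * (P j).eval x := by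
      simp only [Matrix.mul_apply, hankel, hA, Matrix.of_apply, Matrix.map_apply, eval_finsetSum,
        eval_mul, eval_C, hσ]
      simp only [Finset.sum_mul]
      rw [Finset.sum_comm]
      refine Finset.sum_congr rfl fun x _ => ?_
      rw [eval_eq_sum_range' (n := n) (by rw [hPdeg]; exact j.2), ← Fin.sum_univ_eq_sum_range
        (fun k => (P j).coeff k * x ^ k), Finset.mul_sum]
      refine Finset.sum_congr rfl fun k _ => ?_
      ring
    rw [h1]
    refine Finset.sum_eq_zero fun x _ => ?_
    by_cases hx : g x = 0
    · simp [hx]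
    · have : (P j).eval x = 0 := by
        simp only [P, hj, if_true, eval_mul, eval_prod]
        rw [Finset.prod_eq_zero (i := x) (by simp [hB, hx]) (by simp), zero_mul]
      rw [this, mul_zero]
  have hdvd : ∀ i j : Fin n, (if t ≤ j then X - C y else 1) ∣ (hankel n σ * A) i j := by
    intro i j
    by_cases hj : t ≤ j
    · simpa [hj, dvd_iff_isRoot] using hzero i j hj
    · simp [hj]
  choose Q hQ using hdvd
  have hdet : (hankel n σ).det = (∏ j : Fin n, (if t ≤ j then X - C y else 1)) *
      (Matrix.of Q).det := by
    rw [← Matrix.det_mul_row]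
    calc (hankel n σ).det = (hankel n σ * A).det := by rw [Matrix.det_mul, hAdet, mul_one]
      _ = _ := congrArg _ (Matrix.ext fun i j => hQ i j)
  rw [hdet, Fin.prod_univ_eq_prod_range (fun j => if t ≤ j then X - C y else 1), Finset.prod_ite,
    Finset.prod_const_one, mul_one, Finset.prod_const]
  have hcard : ((Finset.range n).filter fun j => t ≤ j).card = n - t := by
    have : ((Finset.range n).filter fun j => t ≤ j) = Finset.Ico t n := by
      ext j; simp [and_comm]
    rw [this, Nat.card_Ico]
  rw [hcard]
  exact dvd_mul_right _ _

theorem det_hankel_ne_zero (σ : ℕ → F[X]) (g : F → F) (y : F)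
    (hσ : ∀ i, (σ i).eval y = ∑ x, g x * x ^ i) :
    (hankel (Finset.univ.filter fun x => g x ≠ 0).card σ).det ≠ 0 := by
  set B := Finset.univ.filter fun x => g x ≠ 0 with hB
  let e := B.equivFin.symm
  set V : Matrix (Fin B.card) (Fin B.card) F := Matrix.vandermonde fun j => (e j : F) with hV
  have hVdet : V.det ≠ 0 :=
    Matrix.det_vandermonde_ne_zero_iff.2 (Subtype.val_injective.comp e.injective)
  intro h0
  have h1 : (hankel B.card σ).map (eval y) =
      V.transpose * Matrix.diagonal (fun j => g (e j)) * V := by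
    ext i k
    rw [Matrix.mul_apply]
    simp only [Matrix.map_apply, hankel, Matrix.of_apply, hσ,
      Matrix.mul_diagonal, Matrix.transpose_apply, hV, Matrix.vandermonde_apply]
    rw [← Finset.sum_subset (Finset.subset_univ B)
      (fun x _ hx => by
        have : g x = 0 := by simpa [hB] using hx
        simp [this])]
    rw [← Finset.sum_coe_sort B, ← Equiv.sum_comp e]
    refine Finset.sum_congr rfl fun j _ => ?_
    rw [pow_add]; ring
  have h2 := RingHom.map_det (evalRingHom y) (hankel B.card σ)
  rw [h0, map_zero] at h2
  have h3 : (evalRingHom y).mapMatrix (hankel B.card σ) = (hankel B.card σ).map (eval y) := rfl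
  rw [h3, h1, Matrix.det_mul, Matrix.det_mul, Matrix.det_transpose, Matrix.det_diagonal] at h2
  refine mul_ne_zero (mul_ne_zero hVdet (Finset.prod_ne_zero_iff.2 fun j _ => ?_)) hVdet h2.symm
  exact (Finset.mem_filter.1 (e j).2).2

/-- If the power sums `∑ x, f x y * x ^ i` are polynomials in `y` of degree at most `i`, then only
for few `y` can the support of `f · y` be smaller than the support of `f · y₀`. -/
theorem sum_card_support_sub_le (f : F → F → F)
    (hf : ∀ i : ℕ, ∃ σ : F[X], σ.natDegree ≤ i ∧ ∀ y, σ.eval y = ∑ x, f x y * x ^ i) (y₀ : F) :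
    ∑ y, ((Finset.univ.filter fun x => f x y₀ ≠ 0).card -
        (Finset.univ.filter fun x => f x y ≠ 0).card) ≤
      (Finset.univ.filter fun x => f x y₀ ≠ 0).card *
        ((Finset.univ.filter fun x => f x y₀ ≠ 0).card - 1) := by
  choose σ hdeg hσ using hf
  set n := (Finset.univ.filter fun x => f x y₀ ≠ 0).card with hn
  have hne : (hankel n σ).det ≠ 0 := det_hankel_ne_zero σ (fun x => f x y₀) y₀ fun i => hσ i y₀
  have hdvd : (∏ y : F, (X - C y) ^ (n - (Finset.univ.filter fun x => f x y ≠ 0).card)) ∣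
      (hankel n σ).det := by
    refine Finset.prod_dvd_of_coprime ?_ fun y _ =>
      X_sub_C_pow_dvd_det_hankel n σ (fun x => f x y) y fun i => hσ i y
    intro a _ b _ hab
    exact (pairwise_coprime_X_sub_C Function.injective_id hab).pow
  have h1 := natDegree_le_of_dvd hdvd hne
  rw [natDegree_prod_of_monic _ _ fun y _ => (monic_X_sub_C y).pow _] at h1
  simp only [natDegree_pow, natDegree_X_sub_C, mul_one] at h1
  have h2 := natDegree_det_le_sum (hankel n σ) (fun i => i) (fun i => i) fun i j => hdeg _
  have h3 : (∑ i : Fin n, (i : ℕ)) + ∑ i : Fin n, (i : ℕ) = n * (n - 1) := by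
    rw [Fin.sum_univ_eq_sum_range (fun i => i), ← mul_two, Finset.sum_range_id_mul_two]
  exact h1.trans (h2.trans h3.le)

end Hankel

section Geometry

variable {p : ℕ} {F : Type} [Field F]

theorem finrank_sup_of_ne {P Q : PGPoint F 2} (hPQ : P ≠ Q) : finrank F ↥(P.1 ⊔ Q.1) = 2 := by
  have h := Submodule.finrank_sup_add_finrank_inf_eq P.1 Q.1
  have hP := P.2
  have hQ := Q.2
  have h0 : ¬ 1 ≤ finrank F ↥(P.1 ⊓ Q.1) := by
    intro h1
    have e1 := Submodule.eq_of_le_of_finrank_le (inf_le_left : P.1 ⊓ Q.1 ≤ P.1) (hP.trans_le h1)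
    have e2 := Submodule.eq_of_le_of_finrank_le (inf_le_right : P.1 ⊓ Q.1 ≤ Q.1) (hQ.trans_le h1)
    exact hPQ (Subtype.ext (e1.symm.trans e2))
  omega

theorem sup_eq_of_ne {P Q : PGPoint F 2} (hPQ : P ≠ Q) {κ : Submodule F (Fin 3 → F)}
    (hκ : finrank F κ = 2) (hP : P.1 ≤ κ) (hQ : Q.1 ≤ κ) : P.1 ⊔ Q.1 = κ :=
  Submodule.eq_of_le_of_finrank_eq (sup_le hP hQ) ((finrank_sup_of_ne hPQ).trans hκ.symm)

variable [Fintype F]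

instance pgPointFintype : Fintype (PGPoint F 2) := Fintype.ofFinite _

theorem pgWt_eq_card (c : PGPoint F 2 → ZMod p) :
    pgWt p F 2 c = (Finset.univ.filter fun P => c P ≠ 0).card := by
  rw [pgWt, ← Set.ncard_coe_finset]; simp

theorem pgSecant_eq_card (c : PGPoint F 2 → ZMod p) (κ : Submodule F (Fin 3 → F)) :
    pgSecant p F 2 c κ = (Finset.univ.filter fun P : PGPoint F 2 => c P ≠ 0 ∧ P.1 ≤ κ).card := by
  rw [pgSecant, ← Set.ncard_coe_finset]; simp

theorem card_points_of_finrank_two {κ : Submodule F (Fin 3 → F)} (hκ : finrank F κ = 2) :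
    (Finset.univ.filter fun P : PGPoint F 2 => P.1 ≤ κ).card = Fintype.card F + 1 := by
  rw [← Nat.card_eq_fintype_card, ← Projectivization.card_of_finrank_two F κ hκ,
    ← Fintype.card_subtype, ← Nat.card_eq_fintype_card]
  have hmap : ∀ H : Submodule F κ, finrank F (H.map κ.subtype) = finrank F H := fun H =>
    (H.equivMapOfInjective κ.subtype κ.injective_subtype).finrank_eq.symm
  refine (Nat.card_congr ((Projectivization.equivSubmodule F κ).trans ?_)).symm
  refine Equiv.ofBijective (fun H => ⟨⟨H.1.map κ.subtype, (hmap H.1).trans H.2⟩,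
    Submodule.map_subtype_le _ _⟩) ⟨?_, ?_⟩
  · intro H K h
    simp only [Subtype.mk.injEq] at h
    exact Subtype.ext (Submodule.map_injective_of_injective κ.injective_subtype h)
  · rintro ⟨⟨P, hP⟩, hPκ⟩
    have h1 : (P.comap κ.subtype).map κ.subtype = P := by
      rw [Submodule.map_comap_subtype]; exact inf_eq_right.2 hPκ
    refine ⟨⟨P.comap κ.subtype, ?_⟩, ?_⟩
    · rw [← hmap, h1, hP]
    · simpa using h1

/-- Two different lines share at most one point. -/
theorem card_points_inf_le_one {κ κ' : Submodule F (Fin 3 → F)} (hκ : finrank F κ = 2)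
    (hκ' : finrank F κ' = 2) (hne : κ ≠ κ') :
    (Finset.univ.filter fun P : PGPoint F 2 => P.1 ≤ κ ∧ P.1 ≤ κ').card ≤ 1 := by
  rw [Finset.card_le_one]
  intro P hP Q hQ
  simp only [Finset.mem_filter, Finset.mem_univ, true_and] at hP hQ
  by_contra hPQ
  exact hne ((sup_eq_of_ne hPQ hκ hP.1 hQ.1).symm.trans (sup_eq_of_ne hPQ hκ' hP.2 hQ.2))

theorem exists_secant_ge (c : PGPoint F 2 → ZMod p) {P : PGPoint F 2} (hP : c P ≠ 0) :
    ∃ κ : Submodule F (Fin 3 → F), finrank F κ = 2 ∧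
      pgWt p F 2 c + Fintype.card F ≤ (Fintype.card F + 1) * pgSecant p F 2 c κ := by
  obtain ⟨m, hm⟩ := exists_isCompl P.1
  have hm2 : finrank F m = 2 := by
    have h1 := Submodule.finrank_add_eq_of_isCompl hm
    have h2 := P.2
    rw [finrank_fin_fun] at h1
    omega
  set T := Finset.univ.filter fun R : PGPoint F 2 => R.1 ≤ m with hT
  have hTcard : T.card = Fintype.card F + 1 := card_points_of_finrank_two hm2
  have hPm : ∀ R ∈ T, P ≠ R := by
    rintro R hR rfl
    have h1 : P.1 ≤ m := (Finset.mem_filter.1 hR).2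
    have h2 : P.1 = ⊥ := (disjoint_self.1 (hm.disjoint.mono_right h1))
    have h3 := P.2
    rw [h2, finrank_bot] at h3
    exact zero_ne_one h3
  let S : PGPoint F 2 → Finset (PGPoint F 2) := fun R =>
    Finset.univ.filter fun Q => (c Q ≠ 0 ∧ Q.1 ≤ P.1 ⊔ R.1)
  have hS : ∀ R, ((S R).erase P).card + 1 = pgSecant p F 2 c (P.1 ⊔ R.1) := by
    intro R
    rw [pgSecant_eq_card]
    exact Finset.card_erase_add_one (by simp [S, hP])
  have hcover : (Finset.univ.filter fun Q => c Q ≠ 0).erase P ⊆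
      T.biUnion fun R => (S R).erase P := by
    intro Q hQ
    simp only [Finset.mem_erase, Finset.mem_filter, Finset.mem_univ, true_and] at hQ
    have h1 : (P.1 ⊔ Q.1) ⊔ m = ⊤ := by
      rw [sup_right_comm, hm.sup_eq_top, top_sup_eq]
    have h2 := Submodule.finrank_sup_add_finrank_inf_eq (P.1 ⊔ Q.1) m
    rw [h1, finrank_top, finrank_fin_fun, finrank_sup_of_ne (Ne.symm hQ.1), hm2] at h2
    let R : PGPoint F 2 := ⟨(P.1 ⊔ Q.1) ⊓ m, by omega⟩
    have hR : R ∈ T := by simp [hT, R]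
    have h3 : P.1 ⊔ R.1 = P.1 ⊔ Q.1 := sup_eq_of_ne (hPm R hR)
      (finrank_sup_of_ne (Ne.symm hQ.1)) le_sup_left inf_le_left
    refine Finset.mem_biUnion.2 ⟨R, hR, ?_⟩
    simp only [S, Finset.mem_erase, Finset.mem_filter, Finset.mem_univ, true_and, h3]
    exact ⟨hQ.1, hQ.2, le_sup_right⟩
  have h1 := (Finset.card_le_card hcover).trans Finset.card_biUnion_le
  have h2 : ((Finset.univ.filter fun Q => c Q ≠ 0).erase P).card + 1 = pgWt p F 2 c := by
    rw [pgWt_eq_card]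
    exact Finset.card_erase_add_one (by simp [hP])
  have h3 : ∑ _R ∈ T, (pgWt p F 2 c + Fintype.card F) ≤
      ∑ R ∈ T, (Fintype.card F + 1) * pgSecant p F 2 c (P.1 ⊔ R.1) := by
    simp_rw [← hS]
    rw [Finset.sum_const, ← Finset.mul_sum, Finset.sum_add_distrib, Finset.sum_const, hTcard,
      smul_eq_mul, smul_eq_mul]
    refine Nat.mul_le_mul_left _ ?_
    omega
  obtain ⟨R, hR, h4⟩ := Finset.exists_le_of_sum_le
    (Finset.card_pos.1 (by omega)) h3
  exact ⟨P.1 ⊔ R.1, finrank_sup_of_ne (hPm R hR), h4⟩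

end Geometry

section Coordinates

open Polynomial

theorem exists_natDegree_le_eval_eq_sum {F : Type*} [Field F] [Fintype F] (a b d : F) (i : ℕ) :
    ∃ σ : F[X], σ.natDegree ≤ i ∧
      ∀ y, σ.eval y = ∑ x, (if x * a + b + y * d = 0 then 1 else 0) * x ^ i := by
  by_cases ha : a = 0
  · by_cases hi : i < Fintype.card F - 1
    · refine ⟨0, by simp, fun y => ?_⟩
      rw [eval_zero]
      simp only [ha, mul_zero, zero_add]
      rw [← Finset.mul_sum, FiniteField.sum_pow_lt_card_sub_one F i hi, mul_zero]
    · refine ⟨Lagrange.interpolate Finset.univ id fun y =>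
        ∑ x, (if x * a + b + y * d = 0 then 1 else 0) * x ^ i, ?_, fun y => ?_⟩
      · set σ := Lagrange.interpolate Finset.univ (id : F → F) fun y =>
          ∑ x, (if x * a + b + y * d = 0 then 1 else 0) * x ^ i with hσ
        have h1 : σ.degree < (Finset.univ : Finset F).card :=
          Lagrange.degree_interpolate_lt _ Function.injective_id.injOn
        by_cases h0 : σ = 0
        · simp [h0]
        · have h2 := (natDegree_lt_iff_degree_lt h0).2 h1
          rw [Finset.card_univ] at h2
          omega
      · exact Lagrange.eval_interpolate_at_node (v := (id : F → F)) _
          Function.injective_id.injOn (Finset.mem_univ y)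
  · refine ⟨(C (-b / a) + C (-d / a) * X) ^ i, ?_, fun y => ?_⟩
    · compute_degree
    · have h1 : ∀ x, x * a + b + y * d = 0 ↔ x = -b / a + -d / a * y := by
        intro x
        constructor
        · intro hx
          field_simp
          linear_combination hx
        · rintro rfl
          field_simp
          ring
      simp [h1]

end Coordinates

section Secants

open Polynomial

variable {p : ℕ} {F : Type} [Field F]

/-- The point spanned by `y • b 0 + b 1 + x • b 2`. -/
def affinePoint (b : Basis (Fin 3) F (Fin 3 → F)) (x y : F) : PGPoint F 2 :=
  ⟨Submodule.span F {y • b 0 + b 1 + x • b 2}, finrank_span_singleton fun h => by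
    simpa using congrArg (fun v => b.repr v 1) h⟩

theorem affinePoint_injective (b : Basis (Fin 3) F (Fin 3 → F)) :
    Function.Injective fun z : F × F => affinePoint b z.1 z.2 := by
  rintro ⟨x, y⟩ ⟨x', y'⟩ h
  have h1 : y • b 0 + b 1 + x • b 2 ∈ Submodule.span F {y' • b 0 + b 1 + x' • b 2} := by
    have := congrArg Subtype.val h
    simp only [affinePoint] at this
    rw [← this]
    exact Submodule.mem_span_singleton_self _
  obtain ⟨r, hr⟩ := Submodule.mem_span_singleton.1 h1
  have e0 := congrArg (fun v => b.repr v 0) hr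
  have e1 := congrArg (fun v => b.repr v 1) hr
  have e2 := congrArg (fun v => b.repr v 2) hr
  simp at e0 e1 e2
  simp_all

theorem affinePoint_le_ker (b : Basis (Fin 3) F (Fin 3 → F)) (φ : (Fin 3 → F) →ₗ[F] F) (x y : F) :
    (affinePoint b x y).1 ≤ LinearMap.ker φ ↔ x * φ (b 2) + φ (b 1) + y * φ (b 0) = 0 := by
  rw [affinePoint, Submodule.span_singleton_le_iff_mem, LinearMap.mem_ker]
  simp only [map_add, map_smul, smul_eq_mul]
  constructor <;> intro h <;> linear_combination h

theorem exists_eq_ker {κ : Submodule F (Fin 3 → F)} (hκ : finrank F κ = 2) :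
    ∃ φ : (Fin 3 → F) →ₗ[F] F, κ = LinearMap.ker φ := by
  have hlt : κ < ⊤ := lt_top_iff_ne_top.2 fun h => by
    rw [h, finrank_top, finrank_fin_fun] at hκ
    omega
  obtain ⟨φ, hφ, hle⟩ := Submodule.exists_le_ker_of_lt_top κ hlt
  refine ⟨φ, Submodule.eq_of_le_of_finrank_le hle ?_⟩
  have h1 : finrank F (LinearMap.ker φ) < finrank F (Fin 3 → F) :=
    Submodule.finrank_lt fun h => hφ (LinearMap.ker_eq_top.1 h)
  rw [finrank_fin_fun] at h1
  omega

theorem exists_eq_span_singleton (P : PGPoint F 2) : ∃ w, P.1 = Submodule.span F {w} := by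
  have hP : P.1 ≠ ⊥ := fun h => by
    have h1 := P.2
    rw [h, finrank_bot] at h1
    exact zero_ne_one h1
  obtain ⟨w, hw, hw0⟩ := Submodule.exists_mem_ne_zero_of_ne_bot hP
  refine ⟨w, (Submodule.eq_of_le_of_finrank_eq ?_ ?_).symm⟩
  · rwa [Submodule.span_singleton_le_iff_mem]
  · rw [finrank_span_singleton hw0, P.2]

/-- A basis adapted to a point `O` on a line `κ`. -/
theorem exists_basis_of_flag (O : PGPoint F 2) {κ : Submodule F (Fin 3 → F)}
    (hκ : finrank F κ = 2) (hO : O.1 ≤ κ) :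
    ∃ b : Basis (Fin 3) F (Fin 3 → F),
      O.1 = Submodule.span F {b 2} ∧ κ = Submodule.span F {b 1, b 2} := by
  obtain ⟨v₂, h2⟩ := exists_eq_span_singleton O
  have hv₂ : v₂ ≠ 0 := fun h => by
    have h1 := O.2
    rw [h2, h, Submodule.span_zero_singleton, finrank_bot] at h1
    exact zero_ne_one h1
  have hlt : O.1 < κ := lt_of_le_of_ne hO fun h => by
    have h1 := O.2
    rw [h, hκ] at h1
    omega
  obtain ⟨v₁, hv₁, hv₁O⟩ := SetLike.exists_of_lt hlt
  have hκlt : κ < ⊤ := lt_top_iff_ne_top.2 fun h => by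
    rw [h, finrank_top, finrank_fin_fun] at hκ
    omega
  obtain ⟨v₀, -, hv₀⟩ := SetLike.exists_of_lt hκlt
  have hmem : v₂ ∈ κ := hO (h2 ▸ Submodule.mem_span_singleton_self v₂)
  have hli12 : LinearIndependent F ![v₁, v₂] := by
    refine linearIndependent_finCons.2 ⟨?_, ?_⟩
    · exact LinearIndependent.of_subsingleton 0 (by simpa using hv₂)
    · rw [Matrix.range_cons, Matrix.range_empty, Set.union_empty, ← h2]
      exact hv₁O
  have hspan : κ = Submodule.span F {v₁, v₂} := by
    refine (Submodule.eq_of_le_of_finrank_eq ?_ ?_).symm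
    · rw [Submodule.span_le]
      rintro v (rfl | rfl)
      exacts [hv₁, hmem]
    · have h1 := finrank_span_eq_card hli12
      rw [Matrix.range_cons, Matrix.range_cons, Matrix.range_empty, Set.union_empty,
        Set.singleton_union, Fintype.card_fin] at h1
      rw [h1, hκ]
  have hli : LinearIndependent F ![v₀, v₁, v₂] := by
    refine linearIndependent_finCons.2 ⟨hli12, ?_⟩
    rw [Matrix.range_cons, Matrix.range_cons, Matrix.range_empty, Set.union_empty,
      Set.singleton_union, ← hspan]
    exact hv₀
  refine ⟨basisOfLinearIndependentOfCardEqFinrank hli (by simp), ?_, ?_⟩ <;>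
    simp only [coe_basisOfLinearIndependentOfCardEqFinrank]
  exacts [h2, hspan]

variable [Fintype F]

theorem exists_natDegree_le_eval_eq_sum_of_mem [CharP F p]
    {c : PGPoint F 2 → ZMod p} (hc : c ∈ pgCode p F 2) (b : Basis (Fin 3) F (Fin 3 → F)) (i : ℕ) :
    ∃ σ : F[X], σ.natDegree ≤ i ∧
      ∀ y, σ.eval y = ∑ x, ZMod.castHom (dvd_refl p) F (c (affinePoint b x y)) * x ^ i := by
  induction hc using Submodule.span_induction with
  | mem c hc =>
    obtain ⟨H, hH, rfl⟩ := hc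
    obtain ⟨φ, rfl⟩ := exists_eq_ker hH
    obtain ⟨σ, h1, h2⟩ := exists_natDegree_le_eval_eq_sum (φ (b 2)) (φ (b 1)) (φ (b 0)) i
    refine ⟨σ, h1, fun y => (h2 y).trans (Finset.sum_congr rfl fun x _ => ?_)⟩
    simp only [pgInd, affinePoint_le_ker]
    split_ifs <;> simp
  | zero => exact ⟨0, by simp, fun y => by simp⟩
  | add c d _ _ hc hd =>
    obtain ⟨σ, h1, h2⟩ := hc
    obtain ⟨τ, h3, h4⟩ := hd
    refine ⟨σ + τ, (natDegree_add_le _ _).trans (max_le h1 h3), fun y => ?_⟩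
    simp [h2, h4, add_mul, Finset.sum_add_distrib]
  | smul r c _ hc =>
    obtain ⟨σ, h1, h2⟩ := hc
    refine ⟨C (ZMod.castHom (dvd_refl p) F r) * σ, (natDegree_C_mul_le _ _).trans h1, fun y => ?_⟩
    rw [eval_mul, eval_C, h2, Finset.mul_sum]
    refine Finset.sum_congr rfl fun x _ => ?_
    rw [Pi.smul_apply, smul_eq_mul, map_mul, mul_assoc]

/-- The number of points of the support on a line is either small or close to `q + 1`. -/
theorem pgSecant_mul_le_pgWt [Fact p.Prime] [CharP F p] {c : PGPoint F 2 → ZMod p}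
    (hc : c ∈ pgCode p F 2) {κ : Submodule F (Fin 3 → F)} (hκ : finrank F κ = 2) :
    pgSecant p F 2 c κ * (Fintype.card F + 1 - pgSecant p F 2 c κ) ≤ pgWt p F 2 c := by
  by_cases hall : ∃ O : PGPoint F 2, O.1 ≤ κ ∧ c O = 0
  swap
  · have h1 : pgSecant p F 2 c κ = Fintype.card F + 1 := by
      rw [pgSecant_eq_card, ← card_points_of_finrank_two hκ]
      congr 1
      ext P
      simp only [Finset.mem_filter, Finset.mem_univ, true_and, and_iff_right_iff_imp]
      exact fun hP h0 => hall ⟨P, hP, h0⟩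
    simp [h1]
  obtain ⟨O, hO, hcO⟩ := hall
  obtain ⟨b, hb2, hb12⟩ := exists_basis_of_flag O hκ hO
  set s : F → ℕ := fun y => (Finset.univ.filter fun x => c (affinePoint b x y) ≠ 0).card with hs
  have hkey := sum_card_support_sub_le
    (fun x y => ZMod.castHom (dvd_refl p) F (c (affinePoint b x y)))
    (fun i => exists_natDegree_le_eval_eq_sum_of_mem hc b i) 0
  simp only [ne_eq, map_eq_zero] at hkey
  have hwt : ∑ y, s y ≤ pgWt p F 2 c := by
    rw [pgWt_eq_card]
    have h1 : ∑ y, s y =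
        (Finset.univ.filter fun z : F × F => c (affinePoint b z.1 z.2) ≠ 0).card := by
      rw [Finset.card_filter, Fintype.sum_prod_type_right]
      simp only [hs, Finset.card_filter]
    rw [h1]
    refine Finset.card_le_card_of_injOn (fun z => affinePoint b z.1 z.2) ?_
      (affinePoint_injective b).injOn
    intro z hz
    simpa using hz
  have hsec : pgSecant p F 2 c κ = s 0 := by
    rw [pgSecant_eq_card]
    symm
    refine Finset.card_bij (fun x _ => affinePoint b x 0) ?_ ?_ ?_
    · intro x hx
      simp only [Finset.mem_filter, Finset.mem_univ, true_and] at hx ⊢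
      refine ⟨hx, ?_⟩
      rw [affinePoint, Submodule.span_singleton_le_iff_mem, hb12, Submodule.mem_span_pair]
      exact ⟨1, x, by simp⟩
    · intro x _ x' _ h
      have := @affinePoint_injective F _ b (x, 0) (x', 0) h
      simpa using this
    · intro P hP
      simp only [Finset.mem_filter, Finset.mem_univ, true_and] at hP
      obtain ⟨w, hw⟩ := exists_eq_span_singleton P
      have hwκ : w ∈ κ := hP.2 (hw ▸ Submodule.mem_span_singleton_self w)
      rw [hb12, Submodule.mem_span_pair] at hwκ
      obtain ⟨r, t, hrt⟩ := hwκ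
      have hr : r ≠ 0 := by
        rintro rfl
        refine hP.1 (hcO ▸ congrArg c (Subtype.ext (Submodule.eq_of_le_of_finrank_eq ?_ ?_)))
        · rw [hw, hb2, Submodule.span_singleton_le_iff_mem, Submodule.mem_span_singleton]
          exact ⟨t, by simpa using hrt⟩
        · rw [P.2, O.2]
      have hPeq : affinePoint b (t / r) 0 = P := by
        refine Subtype.ext (Submodule.eq_of_le_of_finrank_eq ?_ ?_)
        · rw [affinePoint, hw, Submodule.span_singleton_le_iff_mem, Submodule.mem_span_singleton]
          refine ⟨r⁻¹, ?_⟩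
          rw [← hrt, smul_add, smul_smul, smul_smul, inv_mul_cancel₀ hr, one_smul, zero_smul,
            zero_add, div_eq_inv_mul]
        · rw [P.2, (affinePoint b (t / r) 0).2]
      exact ⟨t / r, by simpa [hPeq] using hP.1, hPeq⟩
  rw [hsec]
  have h1 : ∑ _y : F, s 0 ≤ ∑ y, (s 0 - s y) + ∑ y, s y := by
    rw [← Finset.sum_add_distrib]
    exact Finset.sum_le_sum fun y _ => by omega
  rw [Finset.sum_const, Finset.card_univ, smul_eq_mul] at h1
  have h2 : Fintype.card F * s 0 ≤ s 0 * (s 0 - 1) + pgWt p F 2 c :=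
    h1.trans (add_le_add hkey hwt)
  rcases Nat.eq_zero_or_pos (s 0) with h0 | h0
  · simp [h0]
  obtain ⟨k, hk⟩ := Nat.exists_eq_add_of_le h0
  rcases le_total (s 0) (Fintype.card F + 1) with h3 | h3
  · obtain ⟨l, hl⟩ := Nat.exists_eq_add_of_le h3
    rw [hl, Nat.add_sub_cancel_left]
    have h4 : Fintype.card F = k + l := by omega
    have h5 : s 0 - 1 = k := by omega
    rw [h5, h4] at h2
    nlinarith
  · simp [Nat.sub_eq_zero_of_le h3]

end Secants

section Decomposition

variable {p : ℕ} {F : Type} [Field F] [Fintype F]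

theorem pgWt_eq_pgSecant_add (c : PGPoint F 2 → ZMod p) (κ : Submodule F (Fin 3 → F)) :
    pgWt p F 2 c = pgSecant p F 2 c κ +
      (Finset.univ.filter fun P : PGPoint F 2 => c P ≠ 0 ∧ ¬ P.1 ≤ κ).card := by
  rw [pgWt_eq_card, pgSecant_eq_card, ← Finset.filter_filter, ← Finset.filter_filter,
    Finset.card_filter_add_card_filter_not]

theorem pgSecant_add_card_zeros (c : PGPoint F 2 → ZMod p) {κ : Submodule F (Fin 3 → F)}
    (hκ : finrank F κ = 2) :
    pgSecant p F 2 c κ + (Finset.univ.filter fun P : PGPoint F 2 => P.1 ≤ κ ∧ c P = 0).card =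
      Fintype.card F + 1 := by
  rw [pgSecant_eq_card, ← card_points_of_finrank_two hκ,
    ← Finset.card_filter_add_card_filter_not
      (s := Finset.univ.filter fun P : PGPoint F 2 => P.1 ≤ κ) (fun P => c P ≠ 0),
    Finset.filter_filter, Finset.filter_filter]
  simp only [not_not, and_comm]

/-- Subtracting a suitable multiple of a suitable line lowers the weight substantially. -/
theorem exists_pgWt_sub_le [Fact p.Prime] [CharP F p] {r : ℝ} (hr : r ^ 2 = Fintype.card F)
    (hpr : (p : ℝ) ≤ r) {c : PGPoint F 2 → ZMod p} (hc : c ∈ pgCode p F 2) (hc0 : c ≠ 0)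
    (hwt : (pgWt p F 2 c : ℝ) ≤ r ^ 3 - r ^ 2) :
    ∃ (κ : Submodule F (Fin 3 → F)) (a : ZMod p), finrank F κ = 2 ∧
      (pgWt p F 2 (c - a • pgInd p F 2 κ) : ℝ) + (r - 1) ^ 2 ≤ pgWt p F 2 c := by
  have hp2 : (2 : ℝ) ≤ p := by exact_mod_cast (Fact.out : p.Prime).two_le
  obtain ⟨P, hP⟩ := Function.ne_iff.1 hc0
  obtain ⟨κ, hκ, hs⟩ := exists_secant_ge c hP
  set s := pgSecant p F 2 c κ with hsdef
  set q := Fintype.card F with hq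
  have gap : ∀ d ∈ pgCode p F 2, (pgSecant p F 2 d κ : ℝ) * (r ^ 2 + 1 - pgSecant p F 2 d κ) ≤
      pgWt p F 2 d := by
    intro d hd
    have h1 := pgSecant_mul_le_pgWt hd hκ
    have h2 := pgSecant_add_card_zeros d hκ
    have h3 : ((q + 1 - pgSecant p F 2 d κ : ℕ) : ℝ) = r ^ 2 + 1 - pgSecant p F 2 d κ := by
      rw [Nat.cast_sub (by omega), hr]
      push_cast
      ring
    rw [← h3]
    exact_mod_cast h1
  have hsR : (pgWt p F 2 c : ℝ) + r ^ 2 ≤ (r ^ 2 + 1) * s := by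
    rw [hr]
    exact_mod_cast hs
  have hgap := gap c hc
  rw [← hsdef] at hgap
  have hsr : r ≤ s := by
    have h1 : r ^ 2 ≤ (s : ℝ) ^ 2 := by nlinarith
    exact le_of_sq_le_sq h1 (Nat.cast_nonneg s)
  have hslarge : r ^ 2 + 1 - r < s := by
    by_contra! h
    nlinarith [mul_nonneg (sub_nonneg.2 hsr) (sub_nonneg.2 h)]
  set T := Finset.univ.filter fun P : PGPoint F 2 => c P ≠ 0 ∧ P.1 ≤ κ with hT
  have hTs : T.card = s := (pgSecant_eq_card c κ).symm
  obtain ⟨a, -, ha⟩ := Finset.exists_le_card_fiber_of_nsmul_le_card_of_maps_to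
    (s := T) (t := Finset.univ.erase (0 : ZMod p)) (f := c) (b := r)
    (fun P hP => by
      simp only [hT, Finset.mem_filter] at hP
      simpa using hP.2.1)
    ⟨1, by simp⟩ (by
      rw [Finset.card_erase_of_mem (Finset.mem_univ _), Finset.card_univ, ZMod.card, hTs,
        nsmul_eq_mul, Nat.cast_sub (Fact.out : p.Prime).one_le]
      push_cast
      nlinarith)
  refine ⟨κ, a, hκ, ?_⟩
  set d := c - a • pgInd p F 2 κ with hd
  have hdmem : d ∈ pgCode p F 2 := Submodule.sub_mem _ hc
    (Submodule.smul_mem _ _ (Submodule.subset_span ⟨κ, hκ, rfl⟩))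
  have hdin : ∀ P : PGPoint F 2, P.1 ≤ κ → d P = c P - a := fun P hP => by simp [hd, pgInd, hP]
  have hdout : ∀ P : PGPoint F 2, ¬ P.1 ≤ κ → d P = c P := fun P hP => by simp [hd, pgInd, hP]
  have hzeros : r ≤ (Finset.univ.filter fun P : PGPoint F 2 => P.1 ≤ κ ∧ d P = 0).card := by
    refine ha.trans (Nat.cast_le.2 (Finset.card_le_card fun P hP => ?_))
    simp only [hT, Finset.mem_filter, Finset.mem_univ, true_and] at hP ⊢
    exact ⟨hP.1.2, by rw [hdin P hP.1.2, hP.2, sub_self]⟩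
  have hd1 := pgSecant_add_card_zeros d hκ
  have hd2 := pgWt_eq_pgSecant_add d κ
  have hc2 := pgWt_eq_pgSecant_add c κ
  have hout : (Finset.univ.filter fun P : PGPoint F 2 => d P ≠ 0 ∧ ¬ P.1 ≤ κ) =
      Finset.univ.filter fun P : PGPoint F 2 => c P ≠ 0 ∧ ¬ P.1 ≤ κ :=
    Finset.filter_congr fun P _ => and_congr_left fun hP => by rw [hdout P hP]
  rw [hout] at hd2
  have hgapd := gap d hdmem
  set z := (Finset.univ.filter fun P : PGPoint F 2 => P.1 ≤ κ ∧ d P = 0).card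
  set o := (Finset.univ.filter fun P : PGPoint F 2 => c P ≠ 0 ∧ ¬ P.1 ≤ κ).card
  set t := pgSecant p F 2 d κ
  have hd1' : (t : ℝ) + z = r ^ 2 + 1 := by rw [hr]; exact_mod_cast hd1
  have hd2' : (pgWt p F 2 d : ℝ) = t + o := by exact_mod_cast hd2
  have hc2' : (pgWt p F 2 c : ℝ) = s + o := by exact_mod_cast hc2
  have hz0 : (0 : ℝ) ≤ z := Nat.cast_nonneg z
  have htr : (t : ℝ) < r := by
    by_contra! h
    nlinarith [mul_nonneg (sub_nonneg.2 h) (sub_nonneg.2 hzeros)]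
  nlinarith

theorem exists_eq_sum_lines [Fact p.Prime] [CharP F p] {r : ℝ} (hr : r ^ 2 = Fintype.card F)
    (hpr : (p : ℝ) ≤ r) (c : PGPoint F 2 → ZMod p) (hc : c ∈ pgCode p F 2)
    (hwt : (pgWt p F 2 c : ℝ) ≤ r ^ 3 - r ^ 2) :
    ∃ (S : Finset (Submodule F (Fin 3 → F))) (α : Submodule F (Fin 3 → F) → ZMod p),
      (∀ κ ∈ S, finrank F κ = 2) ∧ (∀ κ ∈ S, α κ ≠ 0) ∧ c = ∑ κ ∈ S, α κ • pgInd p F 2 κ ∧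
      (S.card : ℝ) * (r - 1) ^ 2 ≤ pgWt p F 2 c := by
  have hp2 : (2 : ℝ) ≤ p := by exact_mod_cast (Fact.out : p.Prime).two_le
  induction hn : pgWt p F 2 c using Nat.strong_induction_on generalizing c with
  | _ n ih =>
  subst hn
  by_cases hc0 : c = 0
  · exact ⟨∅, 0, by simp, by simp, by simpa using hc0, by simp⟩
  obtain ⟨κ, a, hκ, hlt⟩ := exists_pgWt_sub_le hr hpr hc hc0 hwt
  have hpos : 0 < (r - 1) ^ 2 := by nlinarith
  obtain ⟨S, α, hS, hα, hsum, hcard⟩ := ih _ (by exact_mod_cast (by linarith :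
      (pgWt p F 2 (c - a • pgInd p F 2 κ) : ℝ) < pgWt p F 2 c)) (c - a • pgInd p F 2 κ)
    (Submodule.sub_mem _ hc (Submodule.smul_mem _ _ (Submodule.subset_span ⟨κ, hκ, rfl⟩)))
    (by linarith) rfl
  set β : Submodule F (Fin 3 → F) → ZMod p := fun L =>
    (if L ∈ S then α L else 0) + if L = κ then a else 0 with hβ
  refine ⟨(insert κ S).filter fun L => β L ≠ 0, β, ?_, ?_, ?_, ?_⟩
  · intro L hL
    rcases Finset.mem_insert.1 (Finset.mem_filter.1 hL).1 with rfl | h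
    exacts [hκ, hS L h]
  · exact fun L hL => (Finset.mem_filter.1 hL).2
  · have h1 : ∑ L ∈ (insert κ S).filter (fun L => β L ≠ 0), β L • pgInd p F 2 L =
        ∑ L ∈ insert κ S, β L • pgInd p F 2 L :=
      Finset.sum_filter_of_ne fun L _ h h0 => h (by rw [h0, zero_smul])
    rw [h1, sub_eq_iff_eq_add.1 hsum]
    simp only [hβ, add_smul, Finset.sum_add_distrib, ite_smul, zero_smul]
    rw [Finset.sum_ite_mem, Finset.inter_eq_right.2 (Finset.subset_insert κ S),
      Finset.sum_ite_eq' _ κ, if_pos (Finset.mem_insert_self κ S)]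
  · have h1 : (((insert κ S).filter fun L => β L ≠ 0).card : ℝ) ≤ S.card + 1 := by
      exact_mod_cast (Finset.card_filter_le _ _).trans (Finset.card_insert_le κ S)
    nlinarith

variable {S : Finset (Submodule F (Fin 3 → F))} {α : Submodule F (Fin 3 → F) → ZMod p}

theorem pgWt_sum_le (hS : ∀ κ ∈ S, finrank F κ = 2) :
    pgWt p F 2 (∑ κ ∈ S, α κ • pgInd p F 2 κ) ≤ S.card * (Fintype.card F + 1) := by
  rw [pgWt_eq_card]
  refine le_trans (Finset.card_le_card (t := S.biUnion fun κ =>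
    Finset.univ.filter fun P : PGPoint F 2 => P.1 ≤ κ) fun P hP => ?_)
    (Finset.card_biUnion_le_card_mul _ _ _ fun κ hκ => (card_points_of_finrank_two (hS κ hκ)).le)
  rw [Finset.mem_filter, Finset.sum_apply] at hP
  obtain ⟨κ, hκ, h⟩ := Finset.exists_ne_zero_of_sum_ne_zero hP.2
  refine Finset.mem_biUnion.2 ⟨κ, hκ, ?_⟩
  by_contra hP
  simp only [Finset.mem_filter, Finset.mem_univ, true_and] at hP
  simp [pgInd, hP] at h

theorem le_pgWt_sum (hS : ∀ κ ∈ S, finrank F κ = 2) (hα : ∀ κ ∈ S, α κ ≠ 0) :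
    S.card * (Fintype.card F + 1 - (S.card - 1)) ≤
      pgWt p F 2 (∑ κ ∈ S, α κ • pgInd p F 2 κ) := by
  rw [pgWt_eq_card]
  let A : Submodule F (Fin 3 → F) → Finset (PGPoint F 2) := fun κ =>
    (Finset.univ.filter fun P : PGPoint F 2 => P.1 ≤ κ) \
      (S.erase κ).biUnion fun κ' => Finset.univ.filter fun P : PGPoint F 2 => P.1 ≤ κ ∧ P.1 ≤ κ'
  have hA : ∀ κ P, P ∈ A κ ↔ P.1 ≤ κ ∧ ∀ κ' ∈ S, κ' ≠ κ → ¬ P.1 ≤ κ' := by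
    intro κ P
    simp only [A, Finset.mem_sdiff, Finset.mem_filter, Finset.mem_univ, true_and,
      Finset.mem_biUnion, Finset.mem_erase, not_exists, not_and]
    exact and_congr_right fun h => forall_congr' fun κ' => by tauto
  have hcard : ∀ κ ∈ S, Fintype.card F + 1 - (S.card - 1) ≤ (A κ).card := by
    intro κ hκ
    refine le_trans ?_ (Finset.le_card_sdiff _ _)
    rw [card_points_of_finrank_two (hS κ hκ)]
    refine Nat.sub_le_sub_left ?_ _
    refine (Finset.card_biUnion_le_card_mul _ _ 1 fun κ' hκ' => ?_).trans ?_
    · rw [Finset.mem_erase] at hκ'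
      exact card_points_inf_le_one (hS κ hκ) (hS κ' hκ'.2) hκ'.1.symm
    · rw [mul_one, Finset.card_erase_of_mem hκ]
  have hdisj : (S : Set (Submodule F (Fin 3 → F))).PairwiseDisjoint A := by
    intro κ hκ κ' hκ' hne
    refine Finset.disjoint_left.2 fun P h1 h2 => ?_
    exact ((hA κ' P).1 h2).2 κ hκ hne ((hA κ P).1 h1).1
  calc S.card * (Fintype.card F + 1 - (S.card - 1)) ≤ ∑ κ ∈ S, (A κ).card := by
        rw [← smul_eq_mul]; exact Finset.card_nsmul_le_sum _ _ _ hcard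
    _ = (S.biUnion A).card := (Finset.card_biUnion hdisj).symm
    _ ≤ _ := by
      refine Finset.card_le_card fun P hP => ?_
      obtain ⟨κ, hκ, h⟩ := Finset.mem_biUnion.1 hP
      rw [hA] at h
      rw [Finset.mem_filter, Finset.sum_apply, Finset.sum_eq_single_of_mem κ hκ]
      · simpa [pgInd, h.1] using hα κ hκ
      · intro κ' hκ' hne
        simp [pgInd, h.2 κ' hκ' hne]

end Decomposition

/-- The number of lines is determined by the weight. -/
theorem pgCeil_eq_of_bounds {q w m : ℕ} {r : ℝ} (hr : r ^ 2 = q) (hr2 : 2 ≤ r)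
    (hw : (w : ℝ) ≤ r ^ 3 - r ^ 2) (hm : m * (r - 1) ^ 2 ≤ w)
    (hlow : m * (q + 1 - (m - 1)) ≤ w) (hup : w ≤ m * (q + 1)) : pgCeil q w 1 = m := by
  have hθ : pgTheta q 1 = q + 1 := by
    simp [pgTheta, Finset.sum_range_succ, add_comm]
  rw [pgCeil, hθ]
  have hq : (0 : ℚ) < (((q : ℤ) + 1 : ℤ) : ℚ) := by positivity
  rcases Nat.eq_zero_or_pos m with rfl | hm0
  · have : w = 0 := by simpa using hup
    simp [this]
  have hmr' : (m : ℝ) * (r - 1) ≤ r ^ 2 := by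
    have h1 : (m : ℝ) * (r - 1) * (r - 1) ≤ r ^ 2 * (r - 1) := by nlinarith
    exact le_of_mul_le_mul_right h1 (by linarith)
  have hmr2 : (m : ℝ) ≤ r + 2 := by
    by_contra! h
    nlinarith
  have hmq : m ≤ q + 1 := by
    have : (m : ℝ) ≤ q + 1 := by rw [← hr]; nlinarith
    exact_mod_cast this
  have hlow' : (m : ℝ) * (r ^ 2 + 2 - m) ≤ w := by
    have h1 : ((m * (q + 1 - (m - 1)) : ℕ) : ℝ) ≤ w := by exact_mod_cast hlow
    rw [Nat.cast_mul, Nat.cast_sub (by omega), Nat.cast_sub hm0] at h1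
    push_cast at h1
    rw [hr]
    linarith
  have hmr : (m : ℝ) < r := by
    by_contra! h
    nlinarith [mul_nonneg (sub_nonneg.2 h) (sub_nonneg.2 hmr2)]
  have hlt : (m - 1) * (q + 1) < w := by
    have h1 : ((m : ℝ) - 1) * (q + 1) < w := by
      have : (1 : ℝ) ≤ m := by exact_mod_cast hm0
      rw [← hr]
      nlinarith
    have h2 : (((m - 1) * (q + 1) : ℕ) : ℝ) < w := by
      rw [Nat.cast_mul, Nat.cast_sub hm0]
      push_cast
      exact h1
    exact_mod_cast h2
  have hc : ⌈(w : ℚ) / (((q : ℤ) + 1 : ℤ) : ℚ)⌉ = m := by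
    rw [Int.ceil_eq_iff, lt_div_iff₀ hq, div_le_iff₀ hq]
    constructor
    · have h2 : (((m - 1) * (q + 1) : ℕ) : ℚ) < w := by exact_mod_cast hlt
      rw [Nat.cast_mul, Nat.cast_sub hm0] at h2
      push_cast at h2 ⊢
      exact h2
    · exact_mod_cast hup
  rw [hc, Int.toNat_natCast]

/-- Szőnyi–Weiner-type result (Corollary 4): a codeword of `C_1(2,q)` of small weight
is a linear combination of exactly `⌈wt(c)/(q+1)⌉` different lines. -/
theorem statement_0 (p h : ℕ) (hp : p.Prime) (hh : 2 ≤ h) (hq27 : 27 < p ^ h)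
    (F : Type) [Field F] [Fintype F] (hF : Fintype.card F = p ^ h)
    (c : PGPoint F 2 → ZMod p) (hc : c ∈ pgCode p F 2)
    (hwt : (2 < h ∧ (pgWt p F 2 c : ℝ) ≤
              ((p ^ h : ℕ) : ℝ) * Real.sqrt ((p ^ h : ℕ) : ℝ) - ((p ^ h : ℕ) : ℝ)) ∨
           (h = 2 ∧ (pgWt p F 2 c : ℝ) ≤
              (1 / 2) * (p : ℝ) ^ 3 - (9 / 4) * (p : ℝ) ^ 2)) :
    ∃ (L : Fin (pgCeil (p ^ h) (pgWt p F 2 c) 1) → Submodule F (Fin 3 → F))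
      (α : Fin (pgCeil (p ^ h) (pgWt p F 2 c) 1) → ZMod p),
      Function.Injective L ∧ (∀ i, finrank F (L i) = 2) ∧ (∀ i, α i ≠ 0) ∧
      c = fun P => ∑ i, α i * pgInd p F 2 (L i) P := by
  have : Fact p.Prime := ⟨hp⟩
  have : CharP F p := charP_of_card_eq_prime_pow hF
  have hp2 : (2 : ℝ) ≤ p := by exact_mod_cast hp.two_le
  set r := Real.sqrt ((p ^ h : ℕ) : ℝ) with hr
  have hr2 : r ^ 2 = Fintype.card F := by rw [hF]; exact Real.sq_sqrt (Nat.cast_nonneg _)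
  have hpr : (p : ℝ) ≤ r := by
    refine Real.le_sqrt_of_sq_le ?_
    exact_mod_cast Nat.pow_le_pow_right hp.pos hh
  have hbound : (pgWt p F 2 c : ℝ) ≤ r ^ 3 - r ^ 2 := by
    rcases hwt with ⟨-, h1⟩ | ⟨rfl, h1⟩
    · rw [← hF, ← hr2] at h1
      linarith
    · have h2 : r = p := by rw [hr, Nat.cast_pow, Real.sqrt_sq (Nat.cast_nonneg p)]
      rw [h2]
      nlinarith [pow_pos (zero_lt_two.trans_le hp2) 3, sq_nonneg (p : ℝ)]
  obtain ⟨S, α, hS, hα, hsum, hcard⟩ := exists_eq_sum_lines hr2 hpr c hc hbound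
  have hup := pgWt_sum_le (α := α) hS
  have hlow := le_pgWt_sum hS hα
  rw [← hsum] at hup hlow
  have hceil : pgCeil (p ^ h) (pgWt p F 2 c) 1 = S.card :=
    pgCeil_eq_of_bounds (hF ▸ hr2) (hp2.trans hpr) hbound hcard (hF ▸ hlow) (hF ▸ hup)
  rw [hceil]
  refine ⟨fun i => S.equivFin.symm i, fun i => α (S.equivFin.symm i),
    Subtype.val_injective.comp S.equivFin.symm.injective, fun i => hS _ (S.equivFin.symm i).2,
    fun i => hα _ (S.equivFin.symm i).2, funext fun P => ?_⟩
  rw [Equiv.sum_comp S.equivFin.symm (fun L : S => α L * pgInd p F 2 L P),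
    Finset.sum_coe_sort S (fun L => α L * pgInd p F 2 L P)]
  conv_lhs => rw [hsum, Finset.sum_apply]
  simp only [Pi.smul_apply, smul_eq_mul]
end
end

section
/- Under the standing assumptions, let c be a codeword of C_{n−1}(n,q) with wt(c) ≤ W(n,q). Then there is no line l of PG(n,q) such that the number m of points of supp(c) lying on l satisfies Δ_{n,q} + 1 ≤ m ≤ q − Δ_{n,q} + 1. In particular, every line of PG(n,q) is either thin or thick with respect to c. -/
open Module

noncomputable section

open scoped Classical

section Moments

open Polynomial

theorem hankel_pow_dvd {F : Type*} [Field F] (r : ℕ) (h : ℕ → F[X]) (y : F) (S : Finset F)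
    (w : F → F) (hh : ∀ m, (h m).eval y = ∑ x ∈ S, w x * x ^ m) :
    (X - C y) ^ (r - S.card) ∣ (Matrix.of fun i j : Fin r => h (i + j)).det := by
  set f : F[X] := ∏ x ∈ S, (X - C x) with hf
  have hfm : f.Monic := monic_prod_X_sub_C _ _
  have hfd : f.natDegree = S.card := natDegree_finsetProd_X_sub_C_eq_card _ _
  let u : Fin r → F[X] := fun j => if j.1 < S.card then X ^ j.1 else f * X ^ (j.1 - S.card)
  have hum : ∀ j, (u j).Monic := fun j => by
    by_cases hj : j.1 < S.card
    · simpa only [u, if_pos hj] using monic_X_pow _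
    · simpa only [u, if_neg hj] using hfm.mul (monic_X_pow _)
  have hud : ∀ j, (u j).natDegree = j := fun j => by
    by_cases hj : j.1 < S.card
    · simp only [u, if_pos hj, natDegree_X_pow]
    · simp only [u, if_neg hj]
      rw [hfm.natDegree_mul (monic_X_pow _), hfd, natDegree_X_pow]
      omega
  set P : Matrix (Fin r) (Fin r) F := Matrix.of fun i j => (u j).coeff i with hP
  have hPdet : P.det = 1 := Matrix.det_matrixOfPolynomials u hud hum
  have hdet : (Matrix.of fun i j : Fin r => h (i + j)).det
      = ((Matrix.of fun i j : Fin r => h (i + j)) * P.map C).det := by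
    have hC : (P.map C).det = 1 := by
      have := RingHom.map_det (C : F →+* F[X]) P
      rw [hPdet, map_one] at this
      exact this.symm
    rw [Matrix.det_mul, hC, mul_one]
  rw [hdet, Matrix.det_apply]
  have hcol : ∀ i j : Fin r, S.card ≤ j.1 →
      X - C y ∣ ((Matrix.of fun i j : Fin r => h (i + j)) * P.map C) i j := by
    intro i j hj
    rw [dvd_iff_isRoot, IsRoot, Matrix.mul_apply, eval_finsetSum]
    simp only [Matrix.of_apply, Matrix.map_apply, eval_mul, eval_C, hh, P]
    have hz : ∀ x ∈ S, ∑ k : Fin r, x ^ k.1 * (u j).coeff k = 0 := by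
      intro x hx
      have h1 : (u j).eval x = ∑ k ∈ Finset.range r, (u j).coeff k * x ^ k :=
        eval_eq_sum_range' (by rw [hud]; exact j.2) x
      have h2 : (u j).eval x = 0 := by
        simp only [u, if_neg (not_lt.2 hj), eval_mul]
        rw [hf, eval_prod, Finset.prod_eq_zero hx (by simp), zero_mul]
      rw [h2, ← Fin.sum_univ_eq_sum_range (fun k => (u j).coeff k * x ^ k)] at h1
      rw [h1]
      exact Finset.sum_congr rfl fun k _ => mul_comm _ _
    calc ∑ k : Fin r, (∑ x ∈ S, w x * x ^ (i.1 + k.1)) * (u j).coeff k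
        = ∑ x ∈ S, w x * x ^ i.1 * ∑ k : Fin r, x ^ k.1 * (u j).coeff k := by
          simp only [Finset.sum_mul, Finset.mul_sum]
          rw [Finset.sum_comm]
          refine Finset.sum_congr rfl fun x _ => Finset.sum_congr rfl fun k _ => ?_
          ring
      _ = 0 := Finset.sum_eq_zero fun x hx => by rw [hz x hx, mul_zero]
  refine Finset.dvd_sum fun σ _ => ?_
  rw [Units.smul_def, zsmul_eq_mul]
  refine Dvd.dvd.mul_left ?_ _
  have hprod : (X - C y) ^ (r - S.card)
      = ∏ j : Fin r, if S.card ≤ j.1 then X - C y else 1 := by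
    rw [Fin.prod_univ_eq_prod_range (fun j => if S.card ≤ j then X - C y else 1) r,
      Finset.prod_ite, Finset.prod_const_one, mul_one, Finset.prod_const]
    congr 1
    have : (Finset.range r).filter (fun j => S.card ≤ j) = Finset.Ico S.card r := by
      ext j; simp; omega
    rw [this, Nat.card_Ico]
  rw [hprod]
  refine Finset.prod_dvd_prod_of_dvd _ _ fun j _ => ?_
  by_cases hj : S.card ≤ j.1
  · rw [if_pos hj]; exact hcol _ _ hj
  · rw [if_neg hj]; exact one_dvd _

theorem natDegree_hankel_det_le {F : Type*} [Field F] (r : ℕ) (h : ℕ → F[X])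
    (hd : ∀ m, (h m).natDegree ≤ m) :
    (Matrix.of fun i j : Fin r => h (i + j)).det.natDegree ≤ r * (r - 1) := by
  rw [Matrix.det_apply]
  refine natDegree_sum_le_of_forall_le _ _ fun σ _ => ?_
  rw [Units.smul_def, zsmul_eq_mul]
  refine (natDegree_mul_le).trans ?_
  rw [natDegree_intCast, zero_add]
  refine (natDegree_prod_le _ _).trans ?_
  calc ∑ i : Fin r, (h ((σ i).1 + i.1)).natDegree
      ≤ ∑ i : Fin r, ((σ i).1 + i.1) := Finset.sum_le_sum fun i _ => hd _
    _ = r * (r - 1) := by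
      rw [Finset.sum_add_distrib, Equiv.sum_comp σ (fun i : Fin r => i.1),
        Fin.sum_univ_eq_sum_range (fun i => i) r, ← Finset.sum_range_id_mul_two, mul_two]

theorem hankel_det_eval_ne_zero {F : Type*} [Field F] (h : ℕ → F[X]) (y : F) (S : Finset F)
    (w : F → F) (hw : ∀ x ∈ S, w x ≠ 0) (hh : ∀ m, (h m).eval y = ∑ x ∈ S, w x * x ^ m) :
    (Matrix.of fun i j : Fin S.card => h (i + j)).det ≠ 0 := by
  intro h0
  let e := S.equivFin.symm
  let v : Fin S.card → F := fun i => (e i).1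
  have hv : Function.Injective v := Subtype.val_injective.comp e.injective
  have hM : (Matrix.of fun i j : Fin S.card => h (i + j)).map (eval y)
      = (Matrix.vandermonde v).transpose * Matrix.diagonal (fun i => w (v i))
        * Matrix.vandermonde v := by
    ext i j
    rw [Matrix.mul_apply]
    simp only [Matrix.map_apply, Matrix.of_apply, hh, Matrix.mul_diagonal,
      Matrix.transpose_apply, Matrix.vandermonde_apply]
    rw [← Finset.sum_coe_sort, ← Equiv.sum_comp e]
    refine Finset.sum_congr rfl fun k _ => ?_
    simp only [v]
    ring
  have hdet : (((Matrix.of fun i j : Fin S.card => h (i + j)).map (eval y))).det = 0 := by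
    have := RingHom.map_det (evalRingHom y) (Matrix.of fun i j : Fin S.card => h (i + j))
    rw [h0, map_zero] at this
    exact this.symm
  rw [hM, Matrix.det_mul, Matrix.det_mul, Matrix.det_transpose, Matrix.det_diagonal] at hdet
  have hne := Matrix.det_vandermonde_ne_zero_iff.2 hv
  refine absurd hdet (mul_ne_zero (mul_ne_zero hne ?_) hne)
  exact Finset.prod_ne_zero_iff.2 fun i _ => hw _ (e i).2

/-- For every `m`, the `m`-th moment of the row of `g` at `y` is given by a polynomial in `y` of
degree at most `m`. -/
def HasPolyMoments {F : Type*} [Field F] [Fintype F] (g : F → F → F) : Prop :=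
  ∀ m : ℕ, ∃ f : F[X], f.natDegree ≤ m ∧ ∀ y, f.eval y = ∑ x, g x y * x ^ m

/-- If the `m`-th moments of the rows of `g` are given by polynomials of degree at most `m`, then
a row with `s` nonzero entries forces at least `s (q + 1 - s)` nonzero entries in total. -/
theorem support_mul_le_of_moments {F : Type*} [Field F] [Fintype F] (g : F → F → F)
    (hg : HasPolyMoments g) (y₀ : F) :
    (Finset.univ.filter fun x => g x y₀ ≠ 0).card *
        (Fintype.card F + 1 - (Finset.univ.filter fun x => g x y₀ ≠ 0).card)
      ≤ ∑ y, (Finset.univ.filter fun x => g x y ≠ 0).card := by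
  choose h hd he using hg
  let S : F → Finset F := fun y => Finset.univ.filter fun x => g x y ≠ 0
  have hh : ∀ y m, (h m).eval y = ∑ x ∈ S y, g x y * x ^ m := fun y m => by
    rw [he, Finset.sum_filter_of_ne]
    exact fun x _ hx h0 => hx (by rw [h0, zero_mul])
  change (S y₀).card * (Fintype.card F + 1 - (S y₀).card) ≤ ∑ y, (S y).card
  set r := (S y₀).card with hr
  set D := (Matrix.of fun i j : Fin r => h (i + j)).det with hD
  have hD0 : D ≠ 0 := hankel_det_eval_ne_zero h y₀ (S y₀) (fun x => g x y₀)
    (fun x hx => (Finset.mem_filter.1 hx).2) (hh y₀)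
  have hdvd : ∏ y : F, (X - C y) ^ (r - (S y).card) ∣ D :=
    Finset.prod_dvd_of_coprime
      (fun y _ z _ hyz => ((pairwise_coprime_X_sub_C Function.injective_id hyz).pow))
      (fun y _ => hankel_pow_dvd r h y (S y) (fun x => g x y) (hh y))
  have hdeg : ∑ y : F, (r - (S y).card) ≤ r * (r - 1) := by
    refine le_trans (le_of_eq ?_) ((natDegree_le_of_dvd hdvd hD0).trans
      (natDegree_hankel_det_le r h hd))
    rw [natDegree_prod_of_monic _ _ fun y _ => (monic_X_sub_C y).pow _]
    simp
  have hsum : Fintype.card F * r ≤ ∑ y : F, (r - (S y).card) + ∑ y, (S y).card := by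
    rw [← Finset.sum_add_distrib, ← smul_eq_mul, ← Finset.card_univ]
    exact Finset.card_nsmul_le_sum _ _ _ fun y _ => by omega
  have hrq : r ≤ Fintype.card F := Finset.card_le_univ _
  have hmul : r * (Fintype.card F + 1 - r) + r * (r - 1) = Fintype.card F * r := by
    obtain ⟨k, hk⟩ := Nat.exists_eq_add_of_le hrq
    rcases r with _ | r
    · simp
    · rw [hk, show r + 1 + k + 1 - (r + 1) = k + 1 by omega, Nat.add_sub_cancel]
      ring
  omega
namespace HasPolyMoments

variable {F : Type*} [Field F] [Fintype F] {g g' : F → F → F}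

theorem zero : HasPolyMoments (fun _ _ => 0 : F → F → F) :=
  fun m => ⟨0, by simp, by simp⟩

theorem add (hg : HasPolyMoments g) (hg' : HasPolyMoments g') :
    HasPolyMoments fun x y => g x y + g' x y := fun m => by
  obtain ⟨f, hf, he⟩ := hg m
  obtain ⟨f', hf', he'⟩ := hg' m
  refine ⟨f + f', natDegree_add_le_of_degree_le hf hf', fun y => ?_⟩
  simp only [eval_add, he, he', add_mul, Finset.sum_add_distrib]

theorem const_mul (a : F) (hg : HasPolyMoments g) : HasPolyMoments fun x y => a * g x y :=
  fun m => by
  obtain ⟨f, hf, he⟩ := hg m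
  refine ⟨C a * f, (natDegree_C_mul_le _ _).trans hf, fun y => ?_⟩
  simp only [eval_mul, eval_C, he, Finset.mul_sum, mul_assoc]

theorem of_forall_eq (φ : F → F) : HasPolyMoments fun _ y => φ y := fun m => by
  by_cases hm : m < Fintype.card F - 1
  · refine ⟨0, by simp, fun y => ?_⟩
    rw [← Finset.mul_sum, FiniteField.sum_pow_lt_card_sub_one F m hm, mul_zero, eval_zero]
  · refine ⟨Lagrange.interpolate Finset.univ id fun y => φ y * ∑ x : F, x ^ m, ?_, fun y => ?_⟩
    · refine le_trans ?_ (not_lt.1 hm)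
      have := Lagrange.degree_interpolate_le (s := (Finset.univ : Finset F)) (v := id)
        (fun y => φ y * ∑ x : F, x ^ m) Function.injective_id.injOn
      rw [Finset.card_univ] at this
      exact natDegree_le_of_degree_le this
    · have := Lagrange.eval_interpolate_at_node (s := (Finset.univ : Finset F)) (v := id)
        (fun y => φ y * ∑ x : F, x ^ m) Function.injective_id.injOn (Finset.mem_univ y)
      rw [← Finset.mul_sum, ← this, id]

theorem of_graph (a b : F) : HasPolyMoments fun x y => if x = a + b * y then 1 else 0 :=
  fun m => by
  refine ⟨(C a + C b * X) ^ m, ?_, fun y => by simp⟩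
  refine natDegree_pow_le.trans ?_
  have : (C a + C b * X).natDegree ≤ 1 := by
    rw [add_comm]; exact natDegree_linear_le
  nlinarith

theorem of_linear (a b c : F) :
    HasPolyMoments fun x y => if a + x * b + y * c = 0 then 1 else 0 := by
  by_cases hb : b = 0
  · simpa [hb] using of_forall_eq fun y => if a + y * c = 0 then (1 : F) else 0
  · convert of_graph (-a / b) (-c / b) using 4 with x y
    constructor
    · intro h
      field_simp
      linear_combination h
    · rintro rfl
      field_simp
      ring

end HasPolyMoments

/-- Codewords have polynomial moments on every affine chart of a plane. -/
theorem hasPolyMoments_of_mem_pgCode {p n : ℕ} {F : Type} [Field F] [Fintype F] [CharP F p]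
    {c : PGPoint F n → ZMod p} (hc : c ∈ pgCode p F n) (A : F → F → PGPoint F n)
    (u v w : Fin (n + 1) → F) (hA : ∀ x y, (A x y).1 = Submodule.span F {v + x • u + y • w}) :
    HasPolyMoments fun x y => ZMod.castHom (dvd_refl p) F (c (A x y)) := by
  induction hc using Submodule.span_induction with
  | mem f hf =>
    obtain ⟨H, hH, rfl⟩ := hf
    have hHne : H < ⊤ := by
      refine lt_top_iff_ne_top.2 fun h => ?_
      rw [h, finrank_top, finrank_fin_fun] at hH
      omega
    obtain ⟨φ, hφ, hHφ⟩ := Submodule.exists_le_ker_of_lt_top H hHne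
    have hker : LinearMap.ker φ = H := by
      refine (Submodule.eq_of_le_of_finrank_le hHφ ?_).symm
      have h1 := LinearMap.finrank_range_add_finrank_ker φ
      rw [LinearMap.range_eq_top.2 (LinearMap.surjective hφ), finrank_top, finrank_self,
        finrank_fin_fun] at h1
      omega
    convert HasPolyMoments.of_linear (φ v) (φ u) (φ w) using 3 with x y
    simp only [pgInd, hA, ← hker, Submodule.span_singleton_le_iff_mem, LinearMap.mem_ker, map_add,
      map_smul, smul_eq_mul]
    split_ifs <;> simp
  | zero => simpa using HasPolyMoments.zero
  | add f f' _ _ hf hf' => simpa using hf.add hf'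
  | smul a f _ hf => simpa using hf.const_mul (ZMod.castHom (dvd_refl p) F a)

end Moments

section Geometry

variable {F : Type} [Field F]

theorem exists_eq_span_singleton_s3 {V : Type*} [AddCommGroup V] [Module F V] {P : Submodule F V}
    (hP : finrank F P = 1) : ∃ z, z ≠ 0 ∧ P = Submodule.span F {z} := by
  obtain ⟨z, hz, hspan⟩ := finrank_eq_one_iff'.1 hP
  refine ⟨z, fun h => hz (Subtype.ext h), le_antisymm (fun y hy => ?_)
    ((Submodule.span_singleton_le_iff_mem _ _).2 z.2)⟩
  obtain ⟨r, hr⟩ := hspan ⟨y, hy⟩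
  exact Submodule.mem_span_singleton.2 ⟨r, congrArg Subtype.val hr⟩

theorem exists_eq_span_add_smul {V : Type*} [AddCommGroup V] [Module F V] {u v : V}
    {P : Submodule F V} (hP : finrank F P = 1) (hPl : P ≤ Submodule.span F {u, v})
    (hPu : P ≠ Submodule.span F {u}) : ∃ x : F, P = Submodule.span F {v + x • u} := by
  obtain ⟨z, hz0, hPz⟩ := exists_eq_span_singleton_s3 hP
  obtain ⟨α, β, hαβ⟩ := Submodule.mem_span_pair.1
    (hPl (hPz ▸ Submodule.mem_span_singleton_self z))
  by_cases hβ : β = 0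
  · rw [hβ, zero_smul, add_zero] at hαβ
    refine absurd ?_ hPu
    have hα : α ≠ 0 := by rintro rfl; exact hz0 (by rw [← hαβ, zero_smul])
    rw [hPz, ← hαβ, Submodule.span_singleton_smul_eq (IsUnit.mk0 α hα)]
  · refine ⟨α / β, ?_⟩
    have : z = β • (v + (α / β) • u) := by
      rw [smul_add, smul_smul, mul_div_cancel₀ _ hβ, ← hαβ, add_comm]
    rw [hPz, this, Submodule.span_singleton_smul_eq (IsUnit.mk0 β hβ)]

theorem span_chart_injective {V : Type*} [AddCommGroup V] [Module F V] {u v w : V}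
    (hI : ∀ a b c : F, a • u + b • v + c • w = 0 → a = 0 ∧ b = 0 ∧ c = 0) {x y x' y' : F}
    (h : Submodule.span F {v + x • u + y • w} = Submodule.span F {v + x' • u + y' • w}) :
    x = x' ∧ y = y' := by
  have hmem : v + x • u + y • w ∈ Submodule.span F {v + x' • u + y' • w} :=
    h ▸ Submodule.mem_span_singleton_self _
  obtain ⟨r, hr⟩ := Submodule.mem_span_singleton.1 hmem
  obtain ⟨h1, h2, h3⟩ := hI (r * x' - x) (r - 1) (r * y' - y) (by
    rw [← sub_eq_zero] at hr
    rw [← hr]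
    module)
  have hr1 : r = 1 := sub_eq_zero.1 h2
  subst hr1
  constructor
  · linear_combination -h1
  · linear_combination -h3

variable [Fintype F] {n : ℕ}

/-- The number of `a`-valued points on a line `l` is restricted by the number of support points
off `l` in any plane through `l`. -/
theorem mul_le_ncard_plane {p : ℕ} [CharP F p] [Fact p.Prime] {c : PGPoint F n → ZMod p}
    (hc : c ∈ pgCode p F n) {l : Submodule F (Fin (n + 1) → F)} (hl : finrank F l = 2)
    {w : Fin (n + 1) → F} (hw : w ∉ l) (a : ZMod p) {k : ℕ}
    (hk : {P : PGPoint F n | P.1 ≤ l ∧ c P = a}.ncard = k + 1) :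
    (Fintype.card F - k) * k ≤
      {P : PGPoint F n | (c P ≠ 0 ∧ ¬ P.1 ≤ l) ∧ P.1 ≤ l ⊔ Submodule.span F {w}}.ncard := by
  obtain ⟨Q, hQl, hQa⟩ : {P : PGPoint F n | P.1 ≤ l ∧ c P = a}.Nonempty :=
    Set.nonempty_of_ncard_ne_zero (by omega)
  obtain ⟨u, hu0, hu⟩ := exists_eq_span_singleton_s3 Q.2
  have hQlt : Q.1 < l := lt_of_le_of_ne hQl fun h => by
    have := Q.2
    rw [h, hl] at this
    omega
  obtain ⟨v, hvl, hvQ⟩ := SetLike.exists_of_lt hQlt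
  have hul : u ∈ l := hQl (hu ▸ Submodule.mem_span_singleton_self u)
  have hI : ∀ a b c : F, a • u + b • v + c • w = 0 → a = 0 ∧ b = 0 ∧ c = 0 := by
    intro a b c h
    have hc0 : c = 0 := by
      by_contra hc0
      refine hw ((Submodule.smul_mem_iff l hc0).1 ?_)
      rw [eq_neg_of_add_eq_zero_right h]
      exact l.neg_mem (l.add_mem (l.smul_mem _ hul) (l.smul_mem _ hvl))
    rw [hc0, zero_smul, add_zero] at h
    have hb0 : b = 0 := by
      by_contra hb0
      refine hvQ ((Submodule.smul_mem_iff Q.1 hb0).1 ?_)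
      rw [eq_neg_of_add_eq_zero_right h, hu]
      exact Submodule.neg_mem _ (Submodule.smul_mem _ _ (Submodule.mem_span_singleton_self u))
    rw [hb0, zero_smul, add_zero] at h
    exact ⟨(smul_eq_zero.1 h).resolve_right hu0, hb0, hc0⟩
  have hluv : Submodule.span F {u, v} = l := by
    have hle : Submodule.span F {u, v} ≤ l :=
      Submodule.span_le.2 (Set.insert_subset hul (Set.singleton_subset_iff.2 hvl))
    refine Submodule.eq_of_le_of_finrank_le hle ?_
    have hlt : Q.1 < Submodule.span F {u, v} := by
      refine lt_of_le_of_ne (hu ▸ Submodule.span_mono (by simp)) fun h => hvQ ?_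
      rw [h]
      exact Submodule.subset_span (by simp)
    have := Submodule.finrank_lt_finrank_of_lt hlt
    rw [Q.2] at this
    omega
  have hne : ∀ x y : F, v + x • u + y • w ≠ 0 := fun x y h => by
    have := hI x 1 y (by rw [one_smul, add_comm (x • u)]; exact h)
    exact one_ne_zero this.2.1
  let A : F → F → PGPoint F n := fun x y =>
    ⟨Submodule.span F {v + x • u + y • w}, finrank_span_singleton (hne x y)⟩
  have hAinj : ∀ {x y x' y'}, A x y = A x' y' → x = x' ∧ y = y' := fun h =>
    span_chart_injective hI (congrArg Subtype.val h)
  have hA0 : ∀ x, (A x 0).1 ≤ l := fun x => by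
    refine (Submodule.span_singleton_le_iff_mem _ _).2 ?_
    rw [zero_smul, add_zero]
    exact l.add_mem hvl (l.smul_mem _ hul)
  have hAl : ∀ x y, y ≠ 0 → ¬ (A x y).1 ≤ l := fun x y hy h => by
    have h := (Submodule.span_singleton_le_iff_mem _ _).1 h
    have h' := (Submodule.add_mem_iff_right l (l.add_mem hvl (l.smul_mem x hul))).1 h
    exact hw ((Submodule.smul_mem_iff l hy).1 h')
  have hAw : ∀ x y, (A x y).1 ≤ l ⊔ Submodule.span F {w} := fun x y =>
    (Submodule.span_singleton_le_iff_mem _ _).2 (Submodule.add_mem_sup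
      (l.add_mem hvl (l.smul_mem _ hul)) (Submodule.smul_mem _ _ (Submodule.mem_span_singleton_self w)))
  have hAQ : ∀ x, A x 0 ≠ Q := fun x h => by
    have h1 : v + x • u + (0 : F) • w ∈ Q.1 := h ▸ Submodule.mem_span_singleton_self _
    rw [zero_smul, add_zero] at h1
    refine hvQ ((Submodule.add_mem_iff_left Q.1 (Q.1.smul_mem x ?_)).1 h1)
    exact hu ▸ Submodule.mem_span_singleton_self u
  have hcase : ∀ P : PGPoint F n, P.1 ≤ l → P = Q ∨ ∃ x, A x 0 = P := fun P hP => by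
    by_cases hPQ : P = Q
    · exact Or.inl hPQ
    · obtain ⟨x, hx⟩ := exists_eq_span_add_smul P.2 (hluv ▸ hP)
        (fun h => hPQ (Subtype.ext (h.trans hu.symm)))
      refine Or.inr ⟨x, Subtype.ext ?_⟩
      simp only [A, zero_smul, add_zero, hx]
  let s : F → Finset F := fun y => Finset.univ.filter fun x =>
    ZMod.castHom (dvd_refl p) F (c (A x y)) + (-ZMod.castHom (dvd_refl p) F a) *
      (if y = 0 then 1 else 0) ≠ 0
  have hs0 : (s 0).card + k = Fintype.card F := by
    have hset : {P : PGPoint F n | P.1 ≤ l ∧ c P = a} =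
        insert Q ((fun x => A x 0) '' {x | x ∉ s 0}) := by
      have hmem : ∀ x, x ∉ s 0 ↔ c (A x 0) = a := fun x => by
        simp only [s, if_true, Finset.mem_filter, Finset.mem_univ, true_and, not_not, mul_one,
          ← sub_eq_add_neg, sub_eq_zero]
        exact (ZMod.castHom (dvd_refl p) F).injective.eq_iff
      ext P
      simp only [Set.mem_ofPred_eq, Set.mem_insert_iff, Set.mem_image, hmem]
      constructor
      · rintro ⟨hP, hPa⟩
        refine (hcase P hP).imp_right ?_
        rintro ⟨x, rfl⟩
        exact ⟨x, hPa, rfl⟩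
      · rintro (rfl | ⟨x, hx, rfl⟩)
        · exact ⟨hQl, hQa⟩
        · exact ⟨hA0 x, hx⟩
    rw [hset, Set.ncard_insert_of_notMem (by rintro ⟨x, _, hx⟩; exact hAQ x hx),
      Set.ncard_image_of_injective _ (fun x x' h => (hAinj h).1)] at hk
    have : {x | x ∉ s 0}.ncard = (s 0)ᶜ.card := by
      rw [← Set.ncard_coe_finset]; congr 1; ext; simp
    rw [this] at hk
    have := (s 0).card_add_card_compl
    omega
  have hmom : HasPolyMoments fun x y => ZMod.castHom (dvd_refl p) F (c (A x y)) +
      (-ZMod.castHom (dvd_refl p) F a) * (if y = 0 then 1 else 0) :=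
    (hasPolyMoments_of_mem_pgCode hc A u v w fun _ _ => rfl).add
      ((HasPolyMoments.of_forall_eq fun y => if y = 0 then 1 else 0).const_mul _)
  have hmain : (s 0).card * (Fintype.card F + 1 - (s 0).card) ≤ ∑ y, (s y).card :=
    support_mul_le_of_moments _ hmom 0
  have hrest : ∑ y ∈ Finset.univ.erase (0 : F), (s y).card ≤
      {P : PGPoint F n | (c P ≠ 0 ∧ ¬ P.1 ≤ l) ∧ P.1 ≤ l ⊔ Submodule.span F {w}}.ncard := by
    rw [← Finset.card_sigma, ← Set.ncard_coe_finset]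
    refine Set.ncard_le_ncard_of_injOn (fun z => A z.2 z.1) ?_ ?_ (Set.toFinite _)
    · rintro ⟨y, x⟩ hz
      simp only [s, Finset.coe_sigma, Set.mem_sigma_iff, Finset.mem_coe, Finset.mem_erase,
        Finset.mem_univ, and_true, Finset.mem_filter, true_and] at hz
      obtain ⟨hy, hx⟩ := hz
      rw [if_neg hy, mul_zero, add_zero] at hx
      exact ⟨⟨fun h => hx (by rw [h, map_zero]), hAl x y hy⟩, hAw x y⟩
    · rintro ⟨y, x⟩ _ ⟨y', x'⟩ _ h
      obtain ⟨rfl, rfl⟩ := hAinj h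
      rfl
  rw [← Finset.add_sum_erase _ _ (Finset.mem_univ (0 : F))] at hmain
  rw [← hs0] at hmain ⊢
  rw [Nat.add_sub_cancel]
  rw [show (s 0).card + k + 1 - (s 0).card = k + 1 by omega, mul_add, mul_one] at hmain
  omega

/-- Some plane through `l` contains at most the average number of the points of `T`. -/
theorem exists_plane_mul_le {l : Submodule F (Fin (n + 1) → F)} (hl : finrank F l = 2)
    (hn : 2 ≤ n) (T : Set (PGPoint F n)) (hT : ∀ P ∈ T, ¬ P.1 ≤ l) :
    ∃ w ∉ l, {P : PGPoint F n | P ∈ T ∧ P.1 ≤ l ⊔ Submodule.span F {w}}.ncard *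
      (Fintype.card F ^ (n + 1) - Fintype.card F ^ 2) ≤
        T.ncard * (Fintype.card F ^ 3 - Fintype.card F ^ 2) := by
  have : Fintype (PGPoint F n) := Fintype.ofFinite _
  have hcard : ∀ M : Submodule F (Fin (n + 1) → F),
      (Finset.univ.filter (· ∈ M)).card = Fintype.card F ^ finrank F M := fun M => by
    rw [← Module.card_eq_pow_finrank (K := F) (V := M), Fintype.card_subtype]
  set W : Finset (Fin (n + 1) → F) := Finset.univ.filter (· ∉ l) with hW
  have hWcard : W.card = Fintype.card F ^ (n + 1) - Fintype.card F ^ 2 := by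
    have h1 := Finset.card_filter_add_card_filter_not (s := (Finset.univ : Finset (Fin (n + 1) → F)))
      (p := (· ∈ l))
    rw [hcard, hl, Finset.card_univ, Fintype.card_fun, Fintype.card_fin] at h1
    exact Nat.eq_sub_of_add_eq' h1
  have hq : 2 ≤ Fintype.card F := Fintype.one_lt_card
  have hWne : W.Nonempty := by
    rw [← Finset.card_pos, hWcard]
    exact Nat.sub_pos_of_lt (Nat.pow_lt_pow_right hq (by omega))
  have hcol : ∀ P ∈ T, (W.filter fun w => P.1 ≤ l ⊔ Submodule.span F {w}).card ≤
      Fintype.card F ^ 3 - Fintype.card F ^ 2 := by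
    intro P hP
    have hsub : (W.filter fun w => P.1 ≤ l ⊔ Submodule.span F {w}) ⊆
        Finset.univ.filter (· ∈ l ⊔ P.1) \ Finset.univ.filter (· ∈ l) := by
      intro w hw
      simp only [W, Finset.mem_filter, Finset.mem_univ, true_and, Finset.mem_sdiff] at hw ⊢
      refine ⟨?_, hw.1⟩
      obtain ⟨z, hzP, hzl⟩ := SetLike.not_le_iff_exists.1 (hT P hP)
      obtain ⟨a, ha, b, hb, hab⟩ := Submodule.mem_sup.1 (hw.2 hzP)
      obtain ⟨r, rfl⟩ := Submodule.mem_span_singleton.1 hb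
      have hr : r ≠ 0 := by
        rintro rfl
        rw [zero_smul, add_zero] at hab
        exact hzl (hab ▸ ha)
      refine (Submodule.smul_mem_iff _ hr).1 ?_
      rw [eq_sub_of_add_eq' hab]
      exact Submodule.sub_mem _ (Submodule.mem_sup_right hzP) (Submodule.mem_sup_left ha)
    refine (Finset.card_le_card hsub).trans ?_
    rw [Finset.card_sdiff_of_subset, hcard, hcard, hl]
    · have h3 := Submodule.finrank_add_le_finrank_add_finrank l P.1
      rw [hl, P.2] at h3
      exact Nat.sub_le_sub_right (Nat.pow_le_pow_right (by omega) h3) _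
    · exact Finset.monotone_filter_right _ fun x _ hx => Submodule.mem_sup_left hx
  have hdc : ∑ w ∈ W, (T.toFinset.filter fun P => P.1 ≤ l ⊔ Submodule.span F {w}).card =
      ∑ P ∈ T.toFinset, (W.filter fun w => P.1 ≤ l ⊔ Submodule.span F {w}).card :=
    Finset.sum_card_bipartiteAbove_eq_sum_card_bipartiteBelow
      (fun w (P : PGPoint F n) => P.1 ≤ l ⊔ Submodule.span F {w})
  obtain ⟨w₀, hwW, hw⟩ := Finset.exists_min_image W
    (fun w => (T.toFinset.filter fun P : PGPoint F n => P.1 ≤ l ⊔ Submodule.span F {w}).card) hWne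
  refine ⟨w₀, (Finset.mem_filter.1 hwW).2, ?_⟩
  have hset : {P : PGPoint F n | P ∈ T ∧ P.1 ≤ l ⊔ Submodule.span F {w₀}}.ncard =
      (T.toFinset.filter fun P => P.1 ≤ l ⊔ Submodule.span F {w₀}).card := by
    rw [← Set.ncard_coe_finset]; congr 1; ext; simp
  rw [hset, ← hWcard, mul_comm, ← smul_eq_mul, Set.ncard_eq_toFinset_card']
  refine (Finset.card_nsmul_le_sum W _ _ hw).trans (hdc.trans_le ?_)
  rw [← smul_eq_mul]
  exact Finset.sum_le_card_nsmul _ _ _ fun P hP => hcol P (Set.mem_toFinset.1 hP)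

theorem ncard_points_of_line {l : Submodule F (Fin (n + 1) → F)} (hl : finrank F l = 2) :
    {P : PGPoint F n | P.1 ≤ l}.ncard = Fintype.card F + 1 := by
  rw [← Nat.card_eq_fintype_card, ← Projectivization.card_of_finrank_two F l hl, ← Set.ncard_univ]
  let f : Projectivization F l → PGPoint F n := fun x => ⟨x.submodule.map l.subtype, by
    rw [Submodule.finrank_map_subtype_eq, x.finrank_submodule]⟩
  have hf : Function.Injective f := fun x y h => Projectivization.submodule_injective
    (Submodule.map_injective_of_injective l.subtype_injective (congrArg Subtype.val h))
  rw [← Set.ncard_image_of_injective _ hf, Set.image_univ]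
  congr 1
  ext P
  simp only [Set.mem_ofPred_eq, Set.mem_range]
  constructor
  · intro hP
    have hmap : (P.1.comap l.subtype).map l.subtype = P.1 := by
      rw [Submodule.map_comap_subtype, inf_eq_right.2 hP]
    have hfin : finrank F (P.1.comap l.subtype) = 1 := by
      rw [← Submodule.finrank_map_subtype_eq, hmap, P.2]
    exact ⟨Projectivization.mk'' _ hfin, Subtype.ext (by
      simp only [f, Projectivization.submodule_mk'', hmap])⟩
  · rintro ⟨x, rfl⟩
    exact Submodule.map_subtype_le l x.submodule

/-- The points of a line are partitioned by the values of `c`. -/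
theorem sum_ncard_value_eq {p : ℕ} [NeZero p] (c : PGPoint F n → ZMod p)
    {l : Submodule F (Fin (n + 1) → F)} (hl : finrank F l = 2) :
    ∑ a : ZMod p, {P : PGPoint F n | P.1 ≤ l ∧ c P = a}.ncard = Fintype.card F + 1 := by
  have : Fintype (PGPoint F n) := Fintype.ofFinite _
  have hset : ∀ a, {P : PGPoint F n | P.1 ≤ l ∧ c P = a}.ncard =
      ((Finset.univ.filter fun P : PGPoint F n => P.1 ≤ l).filter fun P => c P = a).card :=
    fun a => by rw [← Set.ncard_coe_finset]; congr 1; ext; simp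
  simp only [hset]
  rw [← Finset.card_eq_sum_card_fiberwise fun _ _ => Finset.mem_coe.2 (Finset.mem_univ _),
    ← Set.ncard_coe_finset, ← ncard_points_of_line hl]
  simp

end Geometry

section Arithmetic

theorem pgDelta_bounds {p h n : ℕ} (hh : 2 ≤ h) (hn : 3 ≤ n)
    (hq1 : 2 < h → max 32 (2 ^ (2 * n - 4)) ≤ p ^ h) (hq2 : h = 2 → 2 ^ (2 * n) ≤ p ^ h) :
    0 ≤ pgDelta p h n ∧ 4 * pgDelta p h n ^ 2 ≤ (p : ℤ) ^ h ∧
      pgDelta p h n + 1 ≤ pgDelta p h 1 := by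
  have hp0 : (0 : ℝ) ≤ p := Nat.cast_nonneg p
  have key : ∀ (s t : ℝ), 0 ≤ s → s ^ 2 ≤ (p : ℝ) ^ h → 0 ≤ t → t ≤ s / 2 →
      0 ≤ ⌊t⌋ ∧ 4 * ⌊t⌋ ^ 2 ≤ (p : ℤ) ^ h := fun s t hs hsp ht hts => by
    have h0 : 0 ≤ ⌊t⌋ := Int.floor_nonneg.2 ht
    refine ⟨h0, ?_⟩
    have h1 : ((⌊t⌋ : ℤ) : ℝ) ≤ s / 2 := (Int.floor_le t).trans hts
    have h2 : (0 : ℝ) ≤ ((⌊t⌋ : ℤ) : ℝ) := by exact_mod_cast h0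
    have : (4 : ℝ) * ((⌊t⌋ : ℤ) : ℝ) ^ 2 ≤ (p : ℝ) ^ h := by nlinarith
    exact_mod_cast this
  have hz : ∀ k : ℕ, 1 ≤ k → (2 : ℝ) ≤ 2 ^ k := fun k hk => by
    simpa using pow_le_pow_right₀ (one_le_two : (1 : ℝ) ≤ 2) hk
  unfold pgDelta
  by_cases h2 : 2 < h
  · simp only [if_pos h2]
    set s := Real.sqrt ((p : ℝ) ^ h) with hs
    have hs0 : 0 ≤ s := Real.sqrt_nonneg _
    have hs2 : s ^ 2 = (p : ℝ) ^ h := Real.sq_sqrt (by positivity)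
    have h32 : (32 : ℝ) ≤ (p : ℝ) ^ h := by exact_mod_cast (le_max_left _ _).trans (hq1 h2)
    have hpow : (2 : ℝ) ^ ((n : ℤ) - 2) = 2 ^ (n - 2) := by
      rw [← zpow_natCast]; congr 1; omega
    have ht : s / 2 ^ ((n : ℤ) - 2) ≤ s / 2 := by
      rw [hpow]
      exact div_le_div_of_nonneg_left hs0 two_pos (hz _ (by omega))
    obtain ⟨k1, k2⟩ := key s _ hs0 hs2.le (by positivity) ht
    refine ⟨k1, k2, Int.le_floor.2 ?_⟩
    have h1 := (Int.floor_le (s / 2 ^ ((n : ℤ) - 2))).trans ht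
    have h3 : s / (2 : ℝ) ^ ((1 : ℤ) - 2) = 2 * s := by norm_num; ring
    rw [h3]
    push_cast
    nlinarith
  · have hh2 : h = 2 := by omega
    subst hh2
    simp only [if_neg h2]
    have h8 : (8 : ℝ) ≤ p := by
      have : 2 ^ 6 ≤ p ^ 2 := (Nat.pow_le_pow_right two_pos (by omega)).trans (hq2 rfl)
      have : 8 ≤ p := by nlinarith
      exact_mod_cast this
    have h4 : (4 : ℝ) ≤ 2 ^ n := by
      have := pow_le_pow_right₀ (one_le_two : (1 : ℝ) ≤ 2) (show 2 ≤ n by omega)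
      linarith
    have ht : (p : ℝ) / 2 ^ (n : ℤ) ≤ p / 4 := by
      rw [zpow_natCast]
      exact div_le_div_of_nonneg_left hp0 (by norm_num) h4
    obtain ⟨k1, k2⟩ := key p _ hp0 le_rfl (by positivity) (ht.trans (by linarith))
    refine ⟨k1, k2, Int.le_floor.2 ?_⟩
    have h1 := (Int.floor_le ((p : ℝ) / 2 ^ (n : ℤ))).trans ht
    rw [zpow_one]
    push_cast
    linarith

theorem pgTheta_natCast_sub_one (q k : ℕ) :
    pgTheta q ((k : ℤ) - 1) = ∑ i ∈ Finset.range k, (q : ℤ) ^ i := by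
  simp [pgTheta]

end Arithmetic

/-- A codeword of weight at most `W(n,q)` has, on every line, either fewer than `Δ + 1` or more
than `q - Δ + 1` support points. -/
theorem pgSecant_le_or_lt {p h n : ℕ} (hp : p.Prime) (hh : 2 ≤ h) (hn : 3 ≤ n)
    {F : Type} [Field F] [Fintype F] (hF : Fintype.card F = p ^ h) {D : ℤ} (hD : 0 ≤ D)
    (hDq : 4 * D ^ 2 ≤ (p : ℤ) ^ h) {c : PGPoint F n → ZMod p} (hc : c ∈ pgCode p F n)
    (hwt : (pgWt p F n c : ℤ) ≤ (D - 1) * ∑ i ∈ Finset.range n, ((p ^ h : ℕ) : ℤ) ^ i)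
    {l : Submodule F (Fin (n + 1) → F)} (hl : finrank F l = 2) :
    (pgSecant p F n c l : ℤ) ≤ D ∨ ((p ^ h : ℕ) : ℤ) - D + 1 < pgSecant p F n c l := by
  have : Fact p.Prime := ⟨hp⟩
  have : CharP F p := by
    have : Fact (Nat.card F = p ^ h) := ⟨by rw [Nat.card_eq_fintype_card, hF]⟩
    exact charP_of_card_eq_prime_pow hF
  by_contra! hcon
  obtain ⟨hm1, hm2⟩ := hcon
  set m := pgSecant p F n c l with hm
  set T : Set (PGPoint F n) := {P | c P ≠ 0 ∧ ¬ P.1 ≤ l} with hT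
  have hTm : T.ncard + m = pgWt p F n c := by
    rw [hm, pgSecant, pgWt, ← Set.ncard_union_eq _ (Set.toFinite _) (Set.toFinite _)]
    · congr 1
      ext P
      simp only [T, Set.mem_union, Set.mem_ofPred_eq]
      tauto
    · rw [Set.disjoint_left]
      rintro P ⟨_, h1⟩ ⟨_, h2⟩
      exact h1 h2
  obtain ⟨w, hw, hle⟩ := exists_plane_mul_le hl (by omega) T fun P hP => hP.2
  set t := {P : PGPoint F n | P ∈ T ∧ P.1 ≤ l ⊔ Submodule.span F {w}}.ncard with ht
  set q := p ^ h with hq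
  rw [hF] at hle
  have hq2 : 2 ≤ q := hF ▸ Fintype.one_lt_card
  have hpq : (p : ℤ) ^ 2 ≤ q := by
    exact_mod_cast Nat.pow_le_pow_right hp.pos hh
  have hDq' : 4 * D ^ 2 ≤ (q : ℤ) := by rw [hq]; exact_mod_cast hDq
  obtain ⟨k, rfl⟩ : ∃ k, n = k + 1 := ⟨n - 1, by omega⟩
  set S : ℤ := ∑ i ∈ Finset.range k, (q : ℤ) ^ i with hS
  have hSpos : 0 < S := by
    refine Finset.sum_pos (fun i _ => by positivity) (Finset.nonempty_range_iff.2 (by omega))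
  have hgeom : S * ((q : ℤ) - 1) = (q : ℤ) ^ k - 1 := geom_sum_mul _ _
  have htS : (t : ℤ) * S ≤ T.ncard := by
    zify [Nat.pow_le_pow_right (show 0 < q by omega) (show 2 ≤ k + 1 + 1 by omega),
      Nat.pow_le_pow_right (show 0 < q by omega) (show 2 ≤ 3 by omega)] at hle
    have hq0 : (0 : ℤ) < (q : ℤ) ^ 2 * (q - 1) := by
      have : (0 : ℤ) < (q : ℤ) - 1 := by omega
      positivity
    refine le_of_mul_le_mul_right ?_ hq0
    calc (t : ℤ) * S * ((q : ℤ) ^ 2 * (q - 1)) = t * ((q : ℤ) ^ 2 * (S * (q - 1))) := by ring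
      _ = t * ((q : ℤ) ^ (k + 1 + 1) - (q : ℤ) ^ 2) := by rw [hgeom]; ring
      _ ≤ _ := hle.trans_eq (by ring)
  have htlt : (t : ℤ) < (D - 1) * q := by
    rw [Finset.sum_range_succ', ← Finset.sum_congr rfl fun i _ => (pow_succ (q : ℤ) i).symm,
      ← Finset.sum_mul, pow_zero] at hwt
    have hwt' : (T.ncard : ℤ) + m ≤ (D - 1) * (S * q + 1) := by
      rw [← Nat.cast_add, hTm]; exact hwt
    nlinarith
  have hval : ∀ a : ZMod p, ({P : PGPoint F (k + 1) | P.1 ≤ l ∧ c P = a}.ncard : ℤ) ≤ D ∨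
      (q : ℤ) - D + 2 ≤ {P : PGPoint F (k + 1) | P.1 ≤ l ∧ c P = a}.ncard := by
    intro a
    rcases hN : {P : PGPoint F (k + 1) | P.1 ≤ l ∧ c P = a}.ncard with _ | j
    · left; simpa using hD
    have hj := mul_le_ncard_plane hc hl hw a hN
    rw [hF] at hj
    by_contra! hcon
    obtain ⟨h1, h2⟩ := hcon
    push_cast at h1 h2
    have hjq : j ≤ q := by omega
    zify [hjq] at hj
    have hj' : ((q : ℤ) - j) * j < (D - 1) * q := lt_of_le_of_lt hj htlt
    nlinarith [mul_nonneg (show (0 : ℤ) ≤ j - D by omega) (show (0 : ℤ) ≤ q - D - j by omega)]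
  obtain ⟨a, ha⟩ : ∃ a : ZMod p,
      (q : ℤ) - D + 2 ≤ {P : PGPoint F (k + 1) | P.1 ≤ l ∧ c P = a}.ncard := by
    by_contra! hall
    have hsum := sum_ncard_value_eq c hl
    rw [hF] at hsum
    have hle : ((∑ a : ZMod p, {P : PGPoint F (k + 1) | P.1 ≤ l ∧ c P = a}.ncard : ℕ) : ℤ) ≤
        p * D := by
      push_cast
      refine (Finset.sum_le_card_nsmul _ _ D fun a _ =>
        (hval a).resolve_right (not_le.2 (hall a))).trans_eq ?_
      rw [Finset.card_univ, ZMod.card, nsmul_eq_mul]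
    have hsum' : (q : ℤ) < p * D := lt_of_lt_of_le (by omega) hle
    nlinarith [sq_nonneg ((p : ℤ) - D)]
  by_cases ha0 : a = 0
  · subst ha0
    have hm0 : {P : PGPoint F (k + 1) | P.1 ≤ l ∧ c P = 0}.ncard + m = q + 1 := by
      rw [hm, pgSecant, ← Set.ncard_union_eq _ (Set.toFinite _) (Set.toFinite _), ← hF,
        ← ncard_points_of_line hl]
      · congr 1
        ext P
        simp only [Set.mem_union, Set.mem_ofPred_eq]
        tauto
      · rw [Set.disjoint_left]
        rintro P ⟨_, h1⟩ ⟨h2, _⟩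
        exact h2 h1
    omega
  · have hsub : {P : PGPoint F (k + 1) | P.1 ≤ l ∧ c P = a}.ncard ≤ m :=
      Set.ncard_le_ncard (fun P hP => ⟨hP.2 ▸ ha0, hP.1⟩) (Set.toFinite _)
    omega

/-- Lemma: for a codeword of weight at most `W(n,q)` there are no `m`-secant lines
with `Δ_{n,q} + 1 ≤ m ≤ q − Δ_{n,q} + 1`; in particular every line is thin or thick. -/
theorem statement_3 (p h n : ℕ) (hp : p.Prime) (hh : 2 ≤ h) (hn : 3 ≤ n)
    (hq1 : 2 < h → max 32 (2 ^ (2 * n - 4)) ≤ p ^ h)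
    (hq2 : h = 2 → 2 ^ (2 * n) ≤ p ^ h)
    (F : Type) [Field F] [Fintype F] (hF : Fintype.card F = p ^ h)
    (c : PGPoint F n → ZMod p) (hc : c ∈ pgCode p F n)
    (hwt : (pgWt p F n c : ℤ) ≤ pgW p h n) :
    (∀ l : Submodule F (Fin (n + 1) → F), finrank F l = 2 →
      ¬ (pgDelta p h n + 1 ≤ (pgSecant p F n c l : ℤ) ∧
         (pgSecant p F n c l : ℤ) ≤ ((p ^ h : ℕ) : ℤ) - pgDelta p h n + 1)) ∧
    (∀ l : Submodule F (Fin (n + 1) → F), finrank F l = 2 →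
      (pgSecant p F n c l : ℤ) ≤ pgW p h 1 ∨ pgU p h n 1 ≤ (pgSecant p F n c l : ℤ)) := by
  obtain ⟨hD, hDq, hD1⟩ := pgDelta_bounds hh hn hq1 hq2
  rw [pgW, pgTheta_natCast_sub_one] at hwt
  have hmain : ∀ l : Submodule F (Fin (n + 1) → F), finrank F l = 2 →
      (pgSecant p F n c l : ℤ) ≤ pgDelta p h n ∨
        ((p ^ h : ℕ) : ℤ) - pgDelta p h n + 1 < pgSecant p F n c l :=
    fun l hl => pgSecant_le_or_lt hp hh hn hF hD hDq hc hwt hl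
  have hW : pgW p h 1 = pgDelta p h 1 - 1 := by simp [pgW, pgTheta]
  have hU : pgU p h n 1 = ((p ^ h : ℕ) : ℤ) - (pgDelta p h n - 2) := by
    simp [pgU, pgTheta, pgQpow]
  refine ⟨fun l hl hm => ?_, fun l hl => ?_⟩
  · rcases hmain l hl with h1 | h1 <;> omega
  · rw [hW, hU]
    rcases hmain l hl with h1 | h1
    · left; omega
    · right; omega
end
end
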